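/- Let (T,m) be a complete local reduced Gorenstein ring of prime characteristic p > 0 with dim T ≥ 2. Let I ⊆ T be a parameter ideal (generated by a system of parameters) and let y ∈ T generate the socle of T/I. Suppose that y^{p^e} ∉ I^{[p^e]} for all sufficiently large e, and that there exists a nonmaximal prime ideal p of T such that M_{I,y} ⊆ p. Then there exists an F-regular local unique factorization domain (A, m∩A) whose (m∩A)-adic completion is isomorphic to T. -/

import Mathlib

open IsLocalRing

/-- The `q`-th Frobenius power `I^{[q]}` of an ideal: the ideal generated by `q`-th powers of
elements of `I`. -/
def Ideal.frobPow {R : Type*} [CommRing R] (I : Ideal R) (q : ℕ) : Ideal R :=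
  Ideal.span ((fun r => r ^ q) '' (I : Set R))

/-- Membership in the tight closure `I*` of an ideal `I` in a ring of characteristic `p`:
there is a `c` outside every minimal prime with `c * x^{p^e} ∈ I^{[p^e]}` for all `e ≫ 0`. -/
def Ideal.MemTightClosure {R : Type*} [CommRing R] (p : ℕ) (I : Ideal R) (x : R) : Prop :=
  ∃ c : R, (∀ P ∈ minimalPrimes R, c ∉ P) ∧
    ∃ E : ℕ, ∀ e : ℕ, E ≤ e → c * x ^ p ^ e ∈ I.frobPow (p ^ e)

/-- A ring of characteristic `p` is weakly F-regular if every ideal is tightly closed. -/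
def WeaklyFRegular (R : Type*) [CommRing R] (p : ℕ) : Prop :=
  ∀ (I : Ideal R) (x : R), I.MemTightClosure p x → x ∈ I

/-- A ring is F-regular if all of its localizations are weakly F-regular. -/
def FRegular (R : Type*) [CommRing R] (p : ℕ) : Prop :=
  ∀ S : Submonoid R, WeaklyFRegular (Localization S) p

/-- A ring is catenary if any two saturated chains of primes with the same endpoints have
the same length. -/
def IsCatenaryRing (R : Type*) [CommRing R] : Prop :=
  ∀ (n m : ℕ) (f : Fin (n + 1) → PrimeSpectrum R) (g : Fin (m + 1) → PrimeSpectrum R),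
    f 0 = g 0 → f (Fin.last n) = g (Fin.last m) →
    (∀ i : Fin n, f i.castSucc ⋖ f i.succ) → (∀ i : Fin m, g i.castSucc ⋖ g i.succ) →
    n = m

/-- `y` generates the socle of `T/I`, i.e. `(I : m) = I + (y)` and `y ∉ I`. -/
def IsSocleGenerator {T : Type*} [CommRing T] [IsLocalRing T] (I : Ideal T) (y : T) : Prop :=
  y ∉ I ∧ I.colon (maximalIdeal T) = I ⊔ Ideal.span {y}

/-- An approximately Gorenstein sequence: a descending chain of `m`-primary ideals with
Gorenstein quotients, cofinal with the powers of `m`. -/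
def IsApproxGorensteinSeq (T : Type*) [CommRing T] [IsLocalRing T] (I : ℕ → Ideal T) : Prop :=
  Antitone I ∧ (∀ s, (I s).radical = maximalIdeal T) ∧
  (∀ s, ∃ y, IsSocleGenerator (I s) y) ∧
  ∀ N : ℕ, ∃ S : ℕ, ∀ s : ℕ, S ≤ s → I s ≤ maximalIdeal T ^ N

/-- The set `M_{I,y} = ⋃_{e ≥ 1} ⋂_{f ≥ e} (I^{[p^f]} : y^{p^f})`. -/
def MIy {T : Type*} [CommRing T] (p : ℕ) (I : Ideal T) (y : T) : Set T :=
  {c : T | ∃ e : ℕ, 1 ≤ e ∧ ∀ f : ℕ, e ≤ f → c * y ^ p ^ f ∈ I.frobPow (p ^ f)}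

/-- `depth T ≥ n`: there is a regular sequence of length `n` in the maximal ideal. -/
def DepthGE (T : Type*) [CommRing T] [IsLocalRing T] (n : ℕ) : Prop :=
  ∃ rs : List T, rs.length = n ∧ (∀ x ∈ rs, x ∈ maximalIdeal T) ∧
    RingTheory.Sequence.IsRegular T rs

/-- A Noetherian local ring is Cohen–Macaulay iff there is a regular sequence in the maximal
ideal of length equal to the Krull dimension. -/
def IsCohenMacaulayLocal (T : Type*) [CommRing T] [IsLocalRing T] : Prop :=
  ∃ rs : List T, (∀ x ∈ rs, x ∈ maximalIdeal T) ∧ RingTheory.Sequence.IsRegular T rs ∧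
    (rs.length : WithBot (WithTop ℕ)) = ringKrullDim T

/-- A parameter ideal: generated by `dim T` elements, with radical the maximal ideal. -/
def IsParameterIdeal (T : Type*) [CommRing T] [IsLocalRing T] (I : Ideal T) : Prop :=
  ∃ (n : ℕ) (x : Fin n → T), I = Ideal.span (Set.range x) ∧ I.radical = maximalIdeal T ∧
    (n : WithBot (WithTop ℕ)) = ringKrullDim T

/-- A Noetherian local ring is Gorenstein iff it is Cohen–Macaulay and every parameter ideal
is irreducible (has one-dimensional socle). -/
def IsGorensteinLocal (T : Type*) [CommRing T] [IsLocalRing T] : Prop :=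
  IsCohenMacaulayLocal T ∧ ∀ I : Ideal T, IsParameterIdeal T I → ∃ y, IsSocleGenerator I y

/-- A `p`-subring of a local ring `T`: a quasi-local subring `(R, R ∩ m)` which is small,
misses `p`, and misses every associated prime of `T`. -/
def IsPSubring (T : Type*) [CommRing T] [IsLocalRing T] (P : Ideal T) (R : Subring T) : Prop :=
  IsLocalRing R ∧ (Ideal.comap R.subtype (maximalIdeal T)).IsMaximal ∧
  (Cardinal.mk R ≤ max Cardinal.aleph0 (Cardinal.mk (ResidueField T)) ∧
    (Cardinal.mk R = max Cardinal.aleph0 (Cardinal.mk (ResidueField T)) →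
      Cardinal.mk (ResidueField T) ≤ Cardinal.aleph0)) ∧
  Ideal.comap R.subtype P = ⊥ ∧
  ∀ Q ∈ associatedPrimes T T, Ideal.comap R.subtype Q = ⊥

/-- An N-subring of a local ring `T`: a quasi-local UFD `(R, R ∩ m)` inside `T` which is small,
misses every associated prime of `T`, and such that `R ∩ J` has height at most one for every
`J ∈ Ass(T/tT)`, `t` a nonzerodivisor. -/
def IsNSubring (T : Type*) [CommRing T] [IsLocalRing T] (R : Subring T) : Prop :=
  IsLocalRing R ∧ (Ideal.comap R.subtype (maximalIdeal T)).IsMaximal ∧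
  (∃ _ : IsDomain R, UniqueFactorizationMonoid R) ∧
  (Cardinal.mk R ≤ max Cardinal.aleph0 (Cardinal.mk (ResidueField T)) ∧
    (Cardinal.mk R = max Cardinal.aleph0 (Cardinal.mk (ResidueField T)) →
      Cardinal.mk (ResidueField T) ≤ Cardinal.aleph0)) ∧
  (∀ Q ∈ associatedPrimes T T, Ideal.comap R.subtype Q = ⊥) ∧
  ∀ t ∈ nonZeroDivisors T, ∀ J ∈ associatedPrimes T (T ⧸ Ideal.span {t}),
    ∀ q0 q1 : Ideal R, q0.IsPrime → q1.IsPrime →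
      ¬(q0 < q1 ∧ q1 < Ideal.comap R.subtype J)

universe u

section RegularModulo

variable {T : Type*} [CommRing T]

/-- `a` is a nonzerodivisor modulo the ideal `J`. -/
def Ideal.IsRegularMod (J : Ideal T) (a : T) : Prop :=
  ∀ t, a * t ∈ J → t ∈ J

/-- `Q` is a prime of the form `(J : u)`, i.e. an associated prime of `T ⧸ J`. -/
def Ideal.IsAssPrime (J Q : Ideal T) : Prop :=
  Q.IsPrime ∧ ∃ u, ∀ q, q ∈ Q ↔ q * u ∈ J

theorem Ideal.IsAssPrime.isAssociatedPrime {J Q : Ideal T} (h : J.IsAssPrime Q) :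
    IsAssociatedPrime Q (T ⧸ J) := by
  obtain ⟨hQ, u, hu⟩ := h
  refine ⟨hQ, Ideal.Quotient.mk J u, ?_⟩
  have : Submodule.colon (⊥ : Submodule T (T ⧸ J)) {Ideal.Quotient.mk J u} = Q := by
    ext q
    rw [Submodule.mem_colon_singleton, hu, Submodule.mem_bot]
    change Ideal.Quotient.mk J (q * u) = 0 ↔ _
    rw [Ideal.Quotient.eq_zero_iff_mem]
  rw [this, hQ.radical]

theorem IsAssociatedPrime.isAssPrime [IsNoetherianRing T] {J Q : Ideal T}
    (h : IsAssociatedPrime Q (T ⧸ J)) : J.IsAssPrime Q := by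
  obtain ⟨hQ, x, hx⟩ := (isAssociatedPrime_iff (I := Q) (M := T ⧸ J)).1 h
  obtain ⟨u, rfl⟩ := Ideal.Quotient.mk_surjective x
  refine ⟨hQ, u, fun q => ?_⟩
  rw [hx, Submodule.mem_colon_singleton, Submodule.mem_bot]
  change Ideal.Quotient.mk J (q * u) = 0 ↔ _
  rw [Ideal.Quotient.eq_zero_iff_mem]

theorem Ideal.finite_isAssPrime [IsNoetherianRing T] (J : Ideal T) :
    {Q | J.IsAssPrime Q}.Finite :=
  (associatedPrimes.finite T (T ⧸ J)).subset fun _ h => h.isAssociatedPrime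

theorem Ideal.exists_isAssPrime_of_mul_mem [IsNoetherianRing T] {J : Ideal T} {b t : T}
    (hbt : b * t ∈ J) (ht : t ∉ J) : ∃ Q, J.IsAssPrime Q ∧ b ∈ Q := by
  obtain ⟨Q, hQ, hle⟩ := exists_le_isAssociatedPrime_of_isNoetherianRing T
    (Ideal.Quotient.mk J t) (by rwa [Ne, Ideal.Quotient.eq_zero_iff_mem])
  refine ⟨Q, hQ.isAssPrime, hle ?_⟩
  rw [Submodule.mem_colon_singleton, Submodule.mem_bot]
  change Ideal.Quotient.mk J (b * t) = 0
  rwa [Ideal.Quotient.eq_zero_iff_mem]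

theorem Ideal.isRegularMod_of_forall_isAssPrime [IsNoetherianRing T] {J : Ideal T} {b : T}
    (h : ∀ Q, J.IsAssPrime Q → b ∉ Q) : J.IsRegularMod b := fun t hbt => by
  by_contra ht
  obtain ⟨Q, hQ, hb⟩ := Ideal.exists_isAssPrime_of_mul_mem hbt ht
  exact h Q hQ hb

namespace Ideal

variable {J Q : Ideal T} {a b c : T}

theorem IsAssPrime.le (h : J.IsAssPrime Q) : J ≤ Q := fun x hx => by
  obtain ⟨-, u, hu⟩ := h
  exact (hu x).2 (J.mul_mem_right u hx)

theorem IsAssPrime.not_isRegularMod (h : J.IsAssPrime Q) (hb : b ∈ Q) : ¬ J.IsRegularMod b := by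
  obtain ⟨hQ, u, hu⟩ := h
  intro hr
  refine hQ.ne_top ((eq_top_iff_one Q).2 ((hu 1).2 ?_))
  rw [one_mul]
  exact hr u ((hu b).1 hb)

/-- Being an associated prime of `T ⧸ a T` only depends on the prime, not on the regular
element `a` it contains. -/
theorem IsAssPrime.of_mem (ha : ∀ t, a * t = 0 → t = 0) (hb : ∀ t, b * t = 0 → t = 0)
    (h : (span {a}).IsAssPrime Q) (hbQ : b ∈ Q) : (span {b}).IsAssPrime Q := by
  obtain ⟨hQ, u, hu⟩ := h
  simp only [mem_span_singleton] at hu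
  obtain ⟨v, hv⟩ := (hu b).1 hbQ
  refine ⟨hQ, v, fun q => ?_⟩
  rw [hu, mem_span_singleton]
  constructor
  · rintro ⟨w, hw⟩
    exact ⟨w, sub_eq_zero.1 (ha _ (by linear_combination b * hw - q * hv))⟩
  · rintro ⟨w, hw⟩
    exact ⟨w, sub_eq_zero.1 (hb _ (by linear_combination a * hw + q * hv))⟩

theorem mem_sup_span {J : Ideal T} {a x : T} :
    x ∈ J ⊔ span {a} ↔ ∃ t, x - a * t ∈ J := by
  rw [Submodule.mem_sup]
  constructor
  · rintro ⟨j, hj, y, hy, rfl⟩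
    obtain ⟨t, rfl⟩ := mem_span_singleton.1 hy
    exact ⟨t, by simpa using hj⟩
  · rintro ⟨t, ht⟩
    exact ⟨_, ht, a * t, mem_span_singleton.2 ⟨t, rfl⟩, by ring⟩

theorem IsRegularMod.pow (h : J.IsRegularMod a) (n : ℕ) : J.IsRegularMod (a ^ n) := by
  induction n with
  | zero => intro t ht; simpa using ht
  | succ n ih => exact fun t ht => ih t (h _ (by rwa [← mul_assoc, ← pow_succ']))

/-- In a regular sequence `a, c` the first element stays regular modulo the second. -/
theorem IsRegularMod.swap_right (ha : J.IsRegularMod a) (hc : (J ⊔ span {a}).IsRegularMod c) :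
    (J ⊔ span {c}).IsRegularMod a := fun t ht => by
  obtain ⟨s, hs⟩ := mem_sup_span.1 ht
  obtain ⟨s', hs'⟩ := mem_sup_span.1 (hc s (mem_sup_span.2 ⟨t, by
    rw [← neg_mem_iff]; simpa using hs⟩))
  refine mem_sup_span.2 ⟨s', ha _ ?_⟩
  convert add_mem hs (J.mul_mem_left c hs') using 1
  ring

theorem IsRegularMod.sup_pow (ha : J.IsRegularMod a) (hc : (J ⊔ span {a}).IsRegularMod c)
    (n : ℕ) : (J ⊔ span {a ^ n}).IsRegularMod c := by
  induction n with
  | zero => intro t _; simp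
  | succ n ih =>
    intro t ht
    obtain ⟨s, hs⟩ := mem_sup_span.1 ht
    obtain ⟨t', ht'⟩ := mem_sup_span.1 (hc t (mem_sup_span.2 ⟨a ^ n * s, by
      convert hs using 1; ring⟩))
    obtain ⟨v, hv⟩ := mem_sup_span.1 (ih t' (mem_sup_span.2 ⟨s, ha _ (by
      convert sub_mem hs (J.mul_mem_left c ht') using 1; ring)⟩))
    refine mem_sup_span.2 ⟨v, ?_⟩
    convert add_mem ht' (J.mul_mem_left a hv) using 1
    ring

end Ideal

end RegularModulo

section Local

variable {T : Type*} [CommRing T] [IsLocalRing T] [IsNoetherianRing T]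

theorem Ideal.mem_of_forall_mem_sup_pow {J : Ideal T} {x : T}
    (h : ∀ n, x ∈ J ⊔ maximalIdeal T ^ n) : x ∈ J := by
  have key := Ideal.iInf_pow_smul_eq_bot_of_isLocalRing (M := T ⧸ J) (maximalIdeal T)
    (maximalIdeal.isMaximal T).ne_top
  have : Ideal.Quotient.mk J x ∈ (⨅ n : ℕ, maximalIdeal T ^ n • ⊤ : Submodule T (T ⧸ J)) := by
    rw [Submodule.mem_iInf]
    intro n
    obtain ⟨j, hj, y, hy, rfl⟩ := Submodule.mem_sup.1 (h n)
    have : Ideal.Quotient.mk J (j + y) = y • (1 : T ⧸ J) := by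
      rw [map_add, Ideal.Quotient.eq_zero_iff_mem.2 hj, zero_add, ← Ideal.Quotient.algebraMap_eq,
        Algebra.algebraMap_eq_smul_one]
    rw [this]
    exact Submodule.smul_mem_smul hy trivial
  rwa [key, Submodule.mem_bot, Ideal.Quotient.eq_zero_iff_mem] at this

end Local

section Avoidance

variable {T : Type*} [CommRing T] [IsLocalRing T] [IsAdicComplete (maximalIdeal T) T]

theorem eq_of_forall_sub_mem_pow {x y : T} (h : ∀ n, x - y ∈ maximalIdeal T ^ n) : x = y := by
  refine sub_eq_zero.1 (IsHausdorff.haus (I := maximalIdeal T) inferInstance _ fun n => ?_)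
  rw [SModEq.zero]
  simpa using h n

theorem exists_adicSum {z : T} (hz : z ∈ maximalIdeal T) (ε : ℕ → T) :
    ∃ L : T, ∀ n, L - ∑ i ∈ Finset.range n, ε i * z ^ i ∈ maximalIdeal T ^ n := by
  obtain ⟨L, hL⟩ := IsPrecomplete.prec (I := maximalIdeal T) (M := T) inferInstance
    (f := fun n => ∑ i ∈ Finset.range n, ε i * z ^ i) (fun {m n} hmn => by
      rw [SModEq.sub_mem, ← neg_mem_iff, neg_sub, ← Finset.sum_Ico_eq_sub _ hmn]
      refine Submodule.sum_mem _ fun i hi => ?_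
      simpa using Ideal.mul_mem_left _ _
        (Ideal.pow_le_pow_right (Finset.mem_Ico.1 hi).1 (Ideal.pow_mem_pow hz i)))
  refine ⟨L, fun n => ?_⟩
  have := (SModEq.sub_mem.1 (hL n))
  rw [← neg_mem_iff, neg_sub]
  simpa using this

/-- The sum of the power series `∑ ε i * z ^ i` in the complete local ring `T`. -/
noncomputable def adicSum {z : T} (hz : z ∈ maximalIdeal T) (ε : ℕ → T) : T :=
  (exists_adicSum hz ε).choose

theorem adicSum_sub_mem {z : T} (hz : z ∈ maximalIdeal T) (ε : ℕ → T) (n : ℕ) :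
    adicSum hz ε - ∑ i ∈ Finset.range n, ε i * z ^ i ∈ maximalIdeal T ^ n :=
  (exists_adicSum hz ε).choose_spec n

theorem adicSum_eq_add {z : T} (hz : z ∈ maximalIdeal T) (ε : ℕ → T) :
    adicSum hz ε = ε 0 + z * adicSum hz (fun i => ε (i + 1)) := by
  refine eq_of_forall_sub_mem_pow fun n => ?_
  have h1 := adicSum_sub_mem hz ε (n + 1)
  have h2 := adicSum_sub_mem hz (fun i => ε (i + 1)) n
  rw [Finset.sum_range_succ'] at h1
  have e : ∑ k ∈ Finset.range n, ε (k + 1) * z ^ (k + 1)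
      = z * ∑ k ∈ Finset.range n, ε (k + 1) * z ^ k := by
    rw [Finset.mul_sum]; exact Finset.sum_congr rfl fun _ _ => by ring
  rw [e] at h1
  convert sub_mem (Ideal.pow_le_pow_right n.le_succ h1) (Ideal.mul_mem_left _ z h2) using 1
  ring

/-- Power series in `z` with coefficients representing distinct sequences of residues stay
distinct modulo every prime that does not contain `z`. -/
theorem adicSum_sub_notMem {z : T} (hz : z ∈ maximalIdeal T) {Q : Ideal T} (hQ : Q.IsPrime)
    (hzQ : z ∉ Q) (n : ℕ) : ∀ ε δ : ℕ → T, (∀ i, ε i = δ i ∨ IsUnit (ε i - δ i)) →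
      ε n ≠ δ n → adicSum hz ε - adicSum hz δ ∉ Q := by
  induction n with
  | zero =>
    intro ε δ h hn hmem
    have hu := (h 0).resolve_left hn
    refine hQ.ne_top (Q.eq_top_of_isUnit_mem hmem ?_)
    rw [adicSum_eq_add hz ε, adicSum_eq_add hz δ]
    by_contra hnu
    refine (mem_maximalIdeal _).1 ?_ hu
    convert sub_mem ((mem_maximalIdeal _).2 hnu) (Ideal.mul_mem_right
      (adicSum hz (fun i => ε (i + 1)) - adicSum hz (fun i => δ (i + 1))) _ hz) using 1
    ring
  | succ n ih =>
    intro ε δ h hn hmem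
    by_cases h0 : ε 0 = δ 0
    · have := ih (fun i => ε (i + 1)) (fun i => δ (i + 1)) (fun i => h _) hn
      rw [adicSum_eq_add hz ε, adicSum_eq_add hz δ, h0, add_sub_add_left_eq_sub, ← mul_sub] at hmem
      exact (hQ.mem_or_mem hmem).elim hzQ this
    · have hu := (h 0).resolve_left h0
      refine hQ.ne_top (Q.eq_top_of_isUnit_mem hmem ?_)
      rw [adicSum_eq_add hz ε, adicSum_eq_add hz δ]
      by_contra hnu
      refine (mem_maximalIdeal _).1 ?_ hu
      convert sub_mem ((mem_maximalIdeal _).2 hnu) (Ideal.mul_mem_right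
        (adicSum hz (fun i => ε (i + 1)) - adicSum hz (fun i => δ (i + 1))) _ hz) using 1
      ring

end Avoidance

theorem residue_out_sub {T : Type*} [CommRing T] [IsLocalRing T] (a b : ResidueField T) :
    Quotient.out a = (Quotient.out b : T) ∨ IsUnit (Quotient.out a - Quotient.out b : T) := by
  by_cases h : a = b
  · exact Or.inl (by rw [h])
  · right
    by_contra hu
    apply h
    rw [← Quotient.out_eq a, ← Quotient.out_eq b]
    exact (Ideal.Quotient.eq).2 ((mem_maximalIdeal _).2 hu)

section Cardinality

open Cardinal

variable (T : Type u) [CommRing T] [IsLocalRing T]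

theorem aleph0_lt_mk_residue_seq : ℵ₀ < #(ℕ → ResidueField T) := by
  rw [mk_arrow, mk_nat, lift_aleph0]
  refine cantor' _ ?_
  rw [one_lt_lift_iff]
  exact one_lt_iff_nontrivial.2 inferInstance

end Cardinality

section AvoidingCosets

open Cardinal

variable {T : Type u} [CommRing T] [IsLocalRing T] [IsAdicComplete (maximalIdeal T) T]

theorem exists_mem_avoiding_of_list {ι : Type u} (hι : #ι < #(ℕ → ResidueField T))
    (Q : ι → Ideal T) (hQ : ∀ i, (Q i).IsPrime) (B : ∀ i, Set (T ⧸ Q i))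
    (hB : ∀ i, (B i).Finite) (J : Ideal T) (L : List (T × T))
    (hL : ∀ x ∈ L, x.1 ∈ maximalIdeal T ∧ x.2 ∈ J) :
    ∃ s ∈ J, ∀ i, (∃ x ∈ L, x.1 ∉ Q i ∧ x.2 ∉ Q i) → Ideal.Quotient.mk (Q i) s ∉ B i := by
  induction L with
  | nil => exact ⟨0, J.zero_mem, by simp⟩
  | cons x L ih =>
    obtain ⟨s, hsJ, hs⟩ := ih fun y hy => hL y (List.mem_cons_of_mem _ hy)
    obtain ⟨hz, hg⟩ := hL x List.mem_cons_self
    let σ : (ℕ → ResidueField T) → T := fun ε => adicSum hz fun n => Quotient.out (ε n)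
    let bad : ι → Set (ℕ → ResidueField T) := fun i =>
      {ε | (x.1 ∉ Q i ∧ x.2 ∉ Q i) ∧ Ideal.Quotient.mk (Q i) (s + x.1 * x.2 * σ ε) ∈ B i}
    have hfin : ∀ i, (bad i).Finite := fun i => by
      by_cases hi : x.1 ∉ Q i ∧ x.2 ∉ Q i
      · refine ((hB i).preimage (f := fun ε => Ideal.Quotient.mk (Q i) (s + x.1 * x.2 * σ ε))
          ?_).subset fun ε hε => hε.2
        intro ε _ δ _ h
        by_contra hne
        obtain ⟨n, hn⟩ := Function.ne_iff.1 hne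
        have h' := Ideal.Quotient.eq.1 h
        rw [add_sub_add_left_eq_sub, ← mul_sub] at h'
        rcases (hQ i).mem_or_mem h' with h' | h'
        · exact ((hQ i).mem_or_mem h').elim hi.1 hi.2
        · refine adicSum_sub_notMem hz (hQ i) hi.1 n _ _ (fun i => residue_out_sub _ _) ?_ h'
          intro he
          apply hn
          rw [← Quotient.out_eq (ε n), ← Quotient.out_eq (δ n), he]
      · exact Set.finite_empty.subset fun ε hε => hi hε.1
    have hlt : #(⋃ i, bad i : Set (ℕ → ResidueField T)) < #(ℕ → ResidueField T) := by
      refine (mk_iUnion_le _).trans_lt ?_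
      have h0 := aleph0_lt_mk_residue_seq T
      refine mul_lt_of_lt h0.le hι ((ciSup_le' fun i => ?_).trans_lt h0)
      exact ((lt_aleph0_iff_set_finite).2 (hfin i)).le
    obtain ⟨ε, hε⟩ : ∃ ε, ε ∉ ⋃ i, bad i := by
      by_contra! h
      rw [Set.eq_univ_of_forall h, mk_univ] at hlt
      exact hlt.false
    rw [Set.mem_iUnion, not_exists] at hε
    refine ⟨s + x.1 * x.2 * σ ε, J.add_mem hsJ (J.mul_mem_right _ (J.mul_mem_left _ hg)), ?_⟩
    rintro i ⟨w, hw, hwi⟩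
    by_cases hi : x.1 ∉ Q i ∧ x.2 ∉ Q i
    · exact fun h => hε i ⟨hi, h⟩
    · have : x.1 * x.2 ∈ Q i := by
        by_cases h1 : x.1 ∈ Q i
        · exact (Q i).mul_mem_right _ h1
        · exact (Q i).mul_mem_left _ (by_contra fun h2 => hi ⟨h1, h2⟩)
      rw [map_add, Ideal.Quotient.eq_zero_iff_mem.2 ((Q i).mul_mem_right (σ ε) this), add_zero]
      refine hs i ⟨w, ?_, hwi⟩
      rcases List.mem_cons.1 hw with rfl | hw
      · exact (hi hwi).elim
      · exact hw

/-- Simultaneous coset avoidance in a complete local ring: fewer than `#k ^ ℵ₀` finite unions of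
cosets of nonmaximal primes not containing `J` do not cover `J`. -/
theorem exists_mem_avoiding [IsNoetherianRing T] {ι : Type u} (hι : #ι < #(ℕ → ResidueField T))
    (Q : ι → Ideal T) (hQ : ∀ i, (Q i).IsPrime) (hM : ∀ i, Q i ≠ maximalIdeal T)
    (B : ∀ i, Set (T ⧸ Q i)) (hB : ∀ i, (B i).Finite) (J : Ideal T) (hJ : ∀ i, ¬ J ≤ Q i) :
    ∃ s ∈ J, ∀ i, Ideal.Quotient.mk (Q i) s ∉ B i := by
  obtain ⟨Z, hZ⟩ := (isNoetherianRing_iff_ideal_fg T).1 ‹_› (maximalIdeal T)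
  obtain ⟨G, hG⟩ := (isNoetherianRing_iff_ideal_fg T).1 ‹_› J
  obtain ⟨s, hs, h⟩ := exists_mem_avoiding_of_list hι Q hQ B hB J (Z ×ˢ G).toList (by
    intro x hx
    rw [Finset.mem_toList, Finset.mem_product] at hx
    exact ⟨hZ ▸ Ideal.subset_span hx.1, hG ▸ Ideal.subset_span hx.2⟩)
  refine ⟨s, hs, fun i => h i ?_⟩
  have h1 : ∃ z ∈ Z, z ∉ Q i := by
    by_contra! hc
    refine hM i ((IsLocalRing.maximalIdeal.isMaximal T).eq_of_le (hQ i).ne_top ?_).symm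
    rw [← hZ]
    exact Ideal.span_le.2 hc
  have h2 : ∃ g ∈ G, g ∉ Q i := by
    by_contra! hc
    exact hJ i (hG ▸ Ideal.span_le.2 hc)
  obtain ⟨z, hz, hz'⟩ := h1
  obtain ⟨g, hg, hg'⟩ := h2
  exact ⟨(z, g), by simp [hz, hg], hz', hg'⟩

/-- Coset avoidance for finitely many primes, in the form `x + J ⊄ ⋃ Q`. -/
theorem exists_mem_forall_add_notMem [IsNoetherianRing T] {S : Set (Ideal T)} (hS : S.Finite)
    (hQ : ∀ Q ∈ S, Q.IsPrime ∧ Q ≠ maximalIdeal T) (x : T) (J : Ideal T)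
    (hJ : ∀ Q ∈ S, J ≤ Q → x ∉ Q) : ∃ s ∈ J, ∀ Q ∈ S, x + s ∉ Q := by
  obtain ⟨s, hs, h⟩ := exists_mem_avoiding (T := T) (ι := {Q // Q ∈ S ∧ ¬ J ≤ Q})
    ((lt_aleph0_iff_set_finite.2 (hS.subset fun Q hQ => hQ.1)).trans (aleph0_lt_mk_residue_seq T))
    (fun Q => Q.1) (fun Q => (hQ _ Q.2.1).1) (fun Q => (hQ _ Q.2.1).2)
    (fun Q => {Ideal.Quotient.mk Q.1 (-x)}) (fun Q => Set.finite_singleton _) J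
    (fun Q => Q.2.2)
  refine ⟨s, hs, fun Q hQS hmem => ?_⟩
  by_cases hJQ : J ≤ Q
  · exact hJ Q hQS hJQ ((Q.add_mem_iff_left (hJQ hs)).1 hmem)
  · refine h ⟨Q, hQS, hJQ⟩ ?_
    rw [Set.mem_singleton_iff, Ideal.Quotient.eq, sub_neg_eq_add, add_comm]
    exact hmem

end AvoidingCosets

section Digits

open Cardinal

variable {T : Type u} [CommRing T] [IsLocalRing T]

theorem exists_digit [IsNoetherianRing T] : ∃ (g : ℕ) (z : Fin g → T),
    (∀ j, z j ∈ maximalIdeal T) ∧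
    ∀ t : T, ∃ c : Fin g → T, t = Quotient.out (residue T t) + ∑ j, z j * c j := by
  obtain ⟨g, z, hz⟩ := Submodule.fg_iff_exists_fin_generating_family.1
    ((isNoetherianRing_iff_ideal_fg T).1 ‹_› (maximalIdeal T))
  refine ⟨g, z, fun j => hz ▸ Ideal.subset_span ⟨j, rfl⟩, fun t => ?_⟩
  have : t - Quotient.out (residue T t) ∈ maximalIdeal T := by
    rw [← Ideal.Quotient.eq]
    exact (Quotient.out_eq (residue T t)).symm
  obtain ⟨c, hc⟩ := (Submodule.mem_span_range_iff_exists_fun T).1 (hz.ge this)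
  refine ⟨c, ?_⟩
  rw [← sub_eq_iff_eq_add', ← hc]
  exact Finset.sum_congr rfl fun _ _ => mul_comm _ _

variable (T) in
theorem mk_le_mk_residue_seq [IsNoetherianRing T] [IsAdicComplete (maximalIdeal T) T] :
    #T ≤ #(ℕ → ResidueField T) := by
  obtain ⟨g, z, hz, h⟩ := exists_digit (T := T)
  choose c hc using h
  let d : List (Fin g) → T → T := fun l t => l.foldl (fun s j => c s j) t
  let D : T → List (Fin g) → ResidueField T := fun t l => residue T (d l t)
  have key : ∀ n, ∀ t t', D t = D t' → t - t' ∈ maximalIdeal T ^ n := by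
    intro n
    induction n with
    | zero => simp
    | succ n ih =>
      intro t t' ht
      have h0 : residue T t = residue T t' := congrFun ht []
      rw [hc t, hc t', h0, add_sub_add_left_eq_sub, ← Finset.sum_sub_distrib]
      refine Ideal.sum_mem _ fun j _ => ?_
      rw [← mul_sub, pow_succ']
      refine Ideal.mul_mem_mul (hz j) (ih _ _ ?_)
      funext l
      exact congrFun ht (j :: l)
  have hinj : Function.Injective D := fun t t' h => eq_of_forall_sub_mem_pow fun n => key n t t' h
  refine (mk_le_of_injective hinj).trans ?_
  have : Function.Injective fun (f : List (Fin g) → ResidueField T) (n : ℕ) =>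
      (Encodable.decode n).elim 0 f := by
    intro f f' h
    funext l
    simpa using congrFun h (Encodable.encode l)
  exact mk_le_of_injective this

end Digits

namespace Ideal

section Chain

variable {T : Type*} [CommRing T]

/-- The list `l` is a (weakly) regular sequence on `T ⧸ J`. -/
def IsRegularChain : Ideal T → List T → Prop
  | _, [] => True
  | J, a :: l => J.IsRegularMod a ∧ IsRegularChain (J ⊔ span {a}) l

variable {J : Ideal T} {a : T} {l : List T}

theorem IsRegularChain.sup_pow (ha : J.IsRegularMod a) (h : IsRegularChain (J ⊔ span {a}) l)
    (n : ℕ) : IsRegularChain (J ⊔ span {a ^ n}) l := by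
  induction l generalizing J with
  | nil => trivial
  | cons c l ih =>
    refine ⟨ha.sup_pow h.1 n, ?_⟩
    rw [sup_right_comm]
    refine ih (ha.swap_right h.1) ?_
    rw [sup_right_comm]
    exact h.2

theorem IsRegularMod.sup_ofList_pow (ha : J.IsRegularMod a)
    (h : IsRegularChain (J ⊔ span {a}) l) (n : ℕ) :
    (J ⊔ ofList (l.map (· ^ n))).IsRegularMod a := by
  induction l generalizing J with
  | nil => simpa using ha
  | cons c l ih =>
    rw [List.map_cons, ofList_cons, ← sup_assoc]
    refine ih (ha.swap_right (h.1.pow n)) ?_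
    rw [sup_right_comm]
    exact IsRegularChain.sup_pow h.1 h.2 n

theorem IsRegularChain.mem_of_mul_prod_pow_mem (h : IsRegularChain J l) (n k : ℕ) {u : T}
    (hu : u * l.prod ^ k ∈ J ⊔ ofList (l.map (· ^ (n + k)))) :
    u ∈ J ⊔ ofList (l.map (· ^ n)) := by
  induction l generalizing J u with
  | nil => simpa using hu
  | cons a l ih =>
    rw [List.map_cons, ofList_cons, ← sup_assoc] at hu ⊢
    have h1 := ih (IsRegularChain.sup_pow h.1 h.2 (n + k)) (u := u * a ^ k) (by
      convert hu using 1
      rw [List.prod_cons]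
      ring)
    rw [sup_right_comm] at h1
    obtain ⟨s, hs⟩ := mem_sup_span.1 h1
    rw [sup_right_comm]
    refine mem_sup_span.2 ⟨s, (h.1.sup_ofList_pow h.2 n).pow k _ ?_⟩
    convert hs using 1
    ring

theorem isRegularChain_of_forall
    (h : ∀ (i : ℕ) (hi : i < l.length), (J ⊔ ofList (l.take i)).IsRegularMod l[i]) :
    IsRegularChain J l := by
  induction l generalizing J with
  | nil => trivial
  | cons c l ih =>
    refine ⟨?_, ih fun i hi => ?_⟩
    · have := h 0 (by simp)
      rw [List.take_zero, ofList_nil, sup_bot_eq] at this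
      exact this
    have := h (i + 1) (by simpa using hi)
    rw [List.take_succ_cons, ofList_cons, ← sup_assoc] at this
    exact this

theorem IsRegularChain.of_isRegular (h : RingTheory.Sequence.IsRegular T l) :
    IsRegularChain ⊥ l := by
  refine isRegularChain_of_forall fun i hi t ht => ?_
  have h1 := h.regular_mod_prev i hi
  rw [bot_sup_eq] at ht ⊢
  have e : (ofList (l.take i) • ⊤ : Submodule T T) = ofList (l.take i) := by simp
  rw [e] at h1
  rw [← Ideal.Quotient.eq_zero_iff_mem]
  refine h1 ?_
  change l[i] • Ideal.Quotient.mk (ofList (l.take i)) t = l[i] • 0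
  rw [smul_zero]
  exact Ideal.Quotient.eq_zero_iff_mem.2 ht

end Chain

section Depth

variable {T : Type*} [CommRing T] [IsLocalRing T]

/-- There is a regular sequence of length `n` on `T ⧸ J` inside the maximal ideal. -/
def HasDepth : Ideal T → ℕ → Prop
  | _, 0 => True
  | J, n + 1 => ∃ a ∈ maximalIdeal T, J.IsRegularMod a ∧ HasDepth (J ⊔ span {a}) n

theorem IsRegularChain.hasDepth {J : Ideal T} {l : List T} (h : IsRegularChain J l)
    (hl : ∀ x ∈ l, x ∈ maximalIdeal T) : HasDepth J l.length := by
  induction l generalizing J with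
  | nil => trivial
  | cons a l ih =>
    exact ⟨a, hl a List.mem_cons_self, h.1, ih h.2 fun x hx => hl x (List.mem_cons_of_mem _ hx)⟩

/-- The socle of `T ⧸ J` vanishes. -/
def IsSocleFree (J : Ideal T) : Prop := ∀ u, (∀ x ∈ maximalIdeal T, x * u ∈ J) → u ∈ J

theorem HasDepth.isSocleFree {J : Ideal T} {n : ℕ} (h : HasDepth J (n + 1)) : J.IsSocleFree := by
  obtain ⟨a, ha, har, -⟩ := h
  exact fun u hu => har u (hu a ha)

theorem IsSocleFree.ne_of_isAssPrime {J Q : Ideal T} (h : J.IsSocleFree) (hQ : J.IsAssPrime Q) :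
    Q ≠ maximalIdeal T := by
  rintro rfl
  obtain ⟨hM, u, hu⟩ := hQ
  refine hM.ne_top ((eq_top_iff_one _).2 ((hu 1).2 ?_))
  rw [one_mul]
  exact h u fun x hx => (hu x).1 hx

theorem IsSocleFree.exchange {J : Ideal T} {a b : T} (haM : a ∈ maximalIdeal T)
    (ha : J.IsRegularMod a) (hb : J.IsRegularMod b) (h : (J ⊔ span {a}).IsSocleFree) :
    (J ⊔ span {b}).IsSocleFree := by
  intro u hu
  obtain ⟨w, hw⟩ := mem_sup_span.1 (hu a haM)
  have hw' : w ∈ J ⊔ span {a} := h w fun x hx => by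
    obtain ⟨s, hs⟩ := mem_sup_span.1 (hu x hx)
    refine mem_sup_span.2 ⟨s, hb _ ?_⟩
    convert sub_mem (J.mul_mem_left a hs) (J.mul_mem_left x hw) using 1
    ring
  obtain ⟨w', hw'⟩ := mem_sup_span.1 hw'
  refine mem_sup_span.2 ⟨w', ha _ ?_⟩
  convert add_mem hw (J.mul_mem_left b hw') using 1
  ring

variable [IsNoetherianRing T] [IsAdicComplete (maximalIdeal T) T]

theorem HasDepth.sup_span {n : ℕ} {J : Ideal T} {b : T} (h : HasDepth J (n + 1))
    (hbM : b ∈ maximalIdeal T) (hb : J.IsRegularMod b) : HasDepth (J ⊔ span {b}) n := by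
  induction n generalizing J b with
  | zero => trivial
  | succ m ih =>
    obtain ⟨a, haM, ha, hd⟩ := h
    have hsa := hd.isSocleFree
    have hsb := hsa.exchange haM ha hb
    obtain ⟨c, hcM, hc⟩ := exists_mem_forall_add_notMem
      ((finite_isAssPrime (J ⊔ span {a})).union (finite_isAssPrime (J ⊔ span {b})))
      (fun Q hQ => hQ.elim (fun hQ => ⟨hQ.1, hsa.ne_of_isAssPrime hQ⟩)
        (fun hQ => ⟨hQ.1, hsb.ne_of_isAssPrime hQ⟩)) 0 (maximalIdeal T) (fun Q hQ hle => by
        have hQ' : Q.IsPrime ∧ Q ≠ maximalIdeal T :=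
          hQ.elim (fun hQ => ⟨hQ.1, hsa.ne_of_isAssPrime hQ⟩)
            (fun hQ => ⟨hQ.1, hsb.ne_of_isAssPrime hQ⟩)
        exact (hQ'.2 ((maximalIdeal.isMaximal T).eq_of_le hQ'.1.ne_top hle).symm).elim)
    simp only [zero_add] at hc
    have hca : (J ⊔ span {a}).IsRegularMod c :=
      isRegularMod_of_forall_isAssPrime fun Q hQ => hc Q (Or.inl hQ)
    have hcb : (J ⊔ span {b}).IsRegularMod c :=
      isRegularMod_of_forall_isAssPrime fun Q hQ => hc Q (Or.inr hQ)
    refine ⟨c, hcM, hcb, ?_⟩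
    rw [sup_right_comm]
    refine ih ⟨a, haM, ha.swap_right hca, ?_⟩ hbM (hb.swap_right hcb)
    rw [sup_right_comm]
    exact ih hd hcM hca

theorem HasDepth.exists_isRegularChain {x : List T} {J : Ideal T} (h : HasDepth J x.length)
    {N : ℕ} (hN : maximalIdeal T ^ N ≤ J ⊔ ofList x) (hM : J ⊔ ofList x ≤ maximalIdeal T) :
    ∃ b : List T, b.length = x.length ∧ (∀ c ∈ b, c ∈ maximalIdeal T) ∧ IsRegularChain J b ∧
      J ⊔ ofList b = J ⊔ ofList x := by
  induction x generalizing J with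
  | nil => exact ⟨[], rfl, by simp, trivial, rfl⟩
  | cons x xs ih =>
    have hne : ∀ Q ∈ {Q | J.IsAssPrime Q}, Q.IsPrime ∧ Q ≠ maximalIdeal T := fun Q hQ =>
      ⟨hQ.1, HasDepth.isSocleFree h |>.ne_of_isAssPrime hQ⟩
    rw [ofList_cons] at hN hM
    obtain ⟨s, hs, hc⟩ := exists_mem_forall_add_notMem (finite_isAssPrime J) hne x (ofList xs)
      (fun Q hQ hle hx => by
        refine (hne Q hQ).2 ((maximalIdeal.isMaximal T).eq_of_le hQ.1.ne_top ?_).symm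
        refine (hQ.1.pow_le_iff ?_).1 (hN.trans (sup_le hQ.le (sup_le ?_ hle)))
        · rintro rfl
          refine (maximalIdeal.isMaximal T).ne_top (top_le_iff.1 (le_trans ?_ hM))
          simpa using hN
        · rwa [span_singleton_le_iff_mem])
    have hb : J.IsRegularMod (x + s) := isRegularMod_of_forall_isAssPrime hc
    have hbM : x + s ∈ maximalIdeal T := hM (mem_sup_right (Submodule.add_mem_sup
      (mem_span_singleton_self x) hs))
    have e : J ⊔ span {x + s} ⊔ ofList xs = J ⊔ (span {x} ⊔ ofList xs) := by
      rw [sup_assoc]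
      congr 1
      refine le_antisymm (sup_le ?_ le_sup_right) (sup_le ?_ le_sup_right)
      · rw [span_singleton_le_iff_mem]
        exact Submodule.add_mem_sup (mem_span_singleton_self x) hs
      · rw [span_singleton_le_iff_mem]
        have := Submodule.add_mem_sup (mem_span_singleton_self (x + s)) (neg_mem hs)
        rwa [add_neg_cancel_right] at this
    obtain ⟨b, hbl, hbm, hbc, hbe⟩ := ih (J := J ⊔ span {x + s}) (HasDepth.sup_span h hbM hb)
      (e ▸ hN) (e ▸ hM)
    refine ⟨(x + s) :: b, by simp [hbl], ?_, ⟨hb, hbc⟩, ?_⟩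
    · intro c hc
      rcases List.mem_cons.1 hc with rfl | hc
      exacts [hbM, hbm c hc]
    · rw [ofList_cons, ofList_cons, ← sup_assoc, hbe, e]

end Depth

end Ideal

section SelfInjective

variable {B : Type*} [CommRing B] [IsLocalRing B]

/-- The socle of `B` is contained in a principal ideal killed by the maximal ideal. -/
def HasCyclicSocle (B : Type*) [CommRing B] [IsLocalRing B] : Prop :=
  ∃ y : B, (∀ x ∈ maximalIdeal B, x * y = 0) ∧
    ∀ u : B, (∀ x ∈ maximalIdeal B, x * u = 0) → u ∈ Ideal.span {y}

theorem HasCyclicSocle.length_hom_le (hB : HasCyclicSocle B) {N : Type*} [AddCommGroup N]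
    [Module B N] (hN : IsFiniteLength B N) :
    Module.length B (N →ₗ[B] B) ≤ Module.length B N := by
  obtain ⟨y, hy, hsoc⟩ := hB
  induction hN with
  | of_subsingleton => simp
  | @of_simple_quotient N _ _ L hs hL ih =>
    have hco : IsCoatom L := isSimpleModule_iff_isCoatom.1 hs
    obtain ⟨x, hx⟩ : ∃ x, x ∉ L := by
      by_contra! h
      exact hco.1 (eq_top_iff.2 fun x _ => h x)
    have hmx : ∀ m ∈ maximalIdeal B, m • x ∈ L := by
      intro m hm
      have h1 : Module.annihilator B (N ⧸ L) = maximalIdeal B :=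
        eq_maximalIdeal (IsSimpleModule.annihilator_isMaximal)
      rw [← h1, Module.mem_annihilator] at hm
      have h2 := hm (L.mkQ x)
      rwa [← map_smul, Submodule.mkQ_apply, Submodule.Quotient.mk_eq_zero] at h2
    let φ : (B ⧸ maximalIdeal B) →ₗ[B] B :=
      Submodule.liftQ (maximalIdeal B) (LinearMap.toSpanSingleton B B y) (fun m hm => by
        simpa using hy m hm)
    have hφ : Module.length B (LinearMap.range φ) ≤ 1 := by
      have : IsSimpleModule B (B ⧸ maximalIdeal B) :=
        isSimpleModule_iff_isCoatom.2 (maximalIdeal.isMaximal B).out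
      rw [← Module.length_eq_one (R := B) (M := B ⧸ maximalIdeal B)]
      exact Module.length_le_of_surjective φ.rangeRestrict φ.surjective_rangeRestrict
    let res : (N →ₗ[B] B) →ₗ[B] (L →ₗ[B] B) := LinearMap.lcomp B B L.subtype
    let ev : LinearMap.ker res →ₗ[B] B := (LinearMap.applyₗ x).comp (LinearMap.ker res).subtype
    have hker : ∀ f : LinearMap.ker res, ∀ n ∈ L, f.1 n = 0 := fun f n hn =>
      LinearMap.congr_fun (LinearMap.mem_ker.1 f.2) ⟨n, hn⟩
    have hev : ∀ f, ev f ∈ LinearMap.range φ := fun f => by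
      obtain ⟨t, ht⟩ := Ideal.mem_span_singleton'.1 (hsoc (f.1 x) fun m hm => by
        rw [← smul_eq_mul, ← map_smul]
        exact hker f _ (hmx m hm))
      exact ⟨Submodule.Quotient.mk t, ht⟩
    have hinj : Function.Injective (ev.codRestrict _ hev) := by
      intro f₁ f₂ h
      have h' : f₁.1 x = f₂.1 x := congrArg Subtype.val h
      rw [← sub_eq_zero]
      generalize hd : f₁ - f₂ = f
      have hf : f.1 x = 0 := by rw [← hd]; exact sub_eq_zero.2 h'
      have hle : L < LinearMap.ker f.1 := lt_of_le_of_ne (fun n hn => hker f n hn) (by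
        intro h
        exact hx (h ▸ hf))
      apply Subtype.ext
      exact LinearMap.ker_eq_top.1 (hco.2 _ hle)
    have h1 : Module.length B (LinearMap.ker res) ≤ 1 :=
      (Module.length_le_of_injective _ hinj).trans hφ
    have h2 : Module.length B (N →ₗ[B] B) = Module.length B (LinearMap.ker res) +
        Module.length B (LinearMap.range res) :=
      Module.length_eq_add_of_exact (LinearMap.ker res).subtype res.rangeRestrict
        (Submodule.subtype_injective _) res.surjective_rangeRestrict
        (by
          rw [LinearMap.exact_iff, LinearMap.ker_rangeRestrict, Submodule.range_subtype])
    have h3 : Module.length B N = Module.length B L + Module.length B (N ⧸ L) :=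
      Module.length_eq_add_of_exact L.subtype L.mkQ (Submodule.subtype_injective _)
        L.mkQ_surjective (by rw [LinearMap.exact_iff, Submodule.ker_mkQ, Submodule.range_subtype])
    rw [h2, h3, Module.length_eq_one (R := B) (M := N ⧸ L), add_comm]
    exact add_le_add ((Module.length_le_of_injective _
      (Submodule.subtype_injective (LinearMap.range res))).trans ih) h1

/-- In an Artinian local ring with cyclic socle, annihilators separate ideals. -/
theorem HasCyclicSocle.exists_mul_ne_zero [IsArtinianRing B] (hB : HasCyclicSocle B) {J : Ideal B}
    {u : B} (hu : u ∉ J) : ∃ k, (∀ j ∈ J, k * j = 0) ∧ k * u ≠ 0 := by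
  by_contra! hc
  let Φ : B →ₗ[B] (J →ₗ[B] B) :=
    (LinearMap.lcomp B B (Submodule.subtype J)).comp (LinearMap.lsmul B B)
  have hΦ : ∀ k, k ∈ LinearMap.ker Φ ↔ ∀ j ∈ J, k * j = 0 := fun k =>
    ⟨fun h j hj => LinearMap.congr_fun (LinearMap.mem_ker.1 h) ⟨j, hj⟩,
      fun h => LinearMap.mem_ker.2 (LinearMap.ext fun j => h j.1 j.2)⟩
  have hk : ∀ k ∈ LinearMap.ker Φ, J ⊔ Ideal.span {u} ≤ LinearMap.ker (LinearMap.lsmul B B k) := by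
    intro k hk
    refine sup_le (fun j hj => (hΦ k).1 hk j hj) ?_
    rw [Ideal.span_singleton_le_iff_mem]
    exact hc k ((hΦ k).1 hk)
  let Ψ : LinearMap.ker Φ →ₗ[B] (B ⧸ (J ⊔ Ideal.span {u})) →ₗ[B] B :=
    { toFun := fun k => Submodule.liftQ _ (LinearMap.lsmul B B k.1) (hk k.1 k.2)
      map_add' := fun k l => by
        refine Submodule.linearMap_qext _ (LinearMap.ext fun b => ?_)
        exact add_mul k.1 l.1 b
      map_smul' := fun k l => by
        refine Submodule.linearMap_qext _ (LinearMap.ext fun b => ?_)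
        exact mul_assoc k l.1 b }
  have hΨ : Function.Injective Ψ := by
    rw [← LinearMap.ker_eq_bot, LinearMap.ker_eq_bot']
    intro k hk
    apply Subtype.ext
    have := LinearMap.congr_fun hk (Submodule.Quotient.mk 1)
    simpa using (show k.1 * 1 = 0 from this)
  have hfin : ∀ (N : Type _) [AddCommGroup N] [Module B N] [Module.Finite B N],
      IsFiniteLength B N := fun N _ _ _ =>
    isFiniteLength_iff_isNoetherian_isArtinian.2 ⟨inferInstance, inferInstance⟩
  have l1 := (Module.length_le_of_injective _ hΨ).trans (hB.length_hom_le (hfin _))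
  have l2 : Module.length B (LinearMap.range Φ) ≤ Module.length B J := by
    refine le_trans (b := Module.length B (J →ₗ[B] B)) ?_ (hB.length_hom_le (hfin J))
    exact Module.length_le_of_injective (LinearMap.range Φ).subtype (Submodule.subtype_injective _)
  have l3 : Module.length B B = Module.length B (LinearMap.ker Φ) +
      Module.length B (LinearMap.range Φ) :=
    Module.length_eq_add_of_exact (LinearMap.ker Φ).subtype Φ.rangeRestrict
      (Submodule.subtype_injective _) Φ.surjective_rangeRestrict
      (by rw [LinearMap.exact_iff, LinearMap.ker_rangeRestrict, Submodule.range_subtype])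
  have l4 : Module.length B B = Module.length B (J ⊔ Ideal.span {u} : Ideal B) +
      Module.length B (B ⧸ (J ⊔ Ideal.span {u})) :=
    Module.length_eq_add_of_exact (Submodule.subtype _) (Submodule.mkQ _)
      (Submodule.subtype_injective _)
      (Submodule.mkQ_surjective _)
      (by rw [LinearMap.exact_iff, Submodule.ker_mkQ, Submodule.range_subtype])
  have l5 : Module.length B J < Module.length B (J ⊔ Ideal.span {u} : Ideal B) := by
    rw [Module.length_submodule, Module.length_submodule]
    refine Submodule.height_strictMono (lt_of_le_of_ne le_sup_left fun h => hu ?_)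
    rw [h]
    exact Ideal.mem_sup_right (Ideal.mem_span_singleton_self u)
  have f1 : Module.length B (B ⧸ (J ⊔ Ideal.span {u})) ≠ ⊤ := Module.length_ne_top
  refine lt_irrefl (Module.length B B) ?_
  calc _ = _ := l3
    _ ≤ Module.length B (B ⧸ (J ⊔ Ideal.span {u})) + Module.length B J := add_le_add l1 l2
    _ < Module.length B (B ⧸ (J ⊔ Ideal.span {u})) +
        Module.length B (J ⊔ Ideal.span {u} : Ideal B) := (ENat.add_lt_add_iff_left f1).2 l5
    _ = _ := by rw [add_comm, ← l4]

end SelfInjective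

section FrobeniusPowers

variable {T : Type*} [CommRing T] {p : ℕ}

theorem Ideal.frobPow_eq_map [ExpChar T p] (I : Ideal T) (e : ℕ) :
    I.frobPow (p ^ e) = I.map (iterateFrobenius T p e) := rfl

theorem Ideal.frobPow_ofList [ExpChar T p] (l : List T) (e : ℕ) :
    (Ideal.ofList l).frobPow (p ^ e) = Ideal.ofList (l.map (· ^ p ^ e)) := by
  rw [frobPow_eq_map, map_ofList]
  rfl

theorem Ideal.pow_mul_mem_frobPow {I J : Ideal T} {k : T} (h : ∀ j ∈ J, k * j ∈ I) {q : ℕ} {x : T}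
    (hx : x ∈ J.frobPow q) : k ^ q * x ∈ I.frobPow q := by
  induction hx using Submodule.span_induction with
  | mem x hx =>
    obtain ⟨j, hj, rfl⟩ := hx
    simp only [← mul_pow]
    exact Ideal.subset_span ⟨_, h j hj, rfl⟩
  | zero => simp
  | add x y _ _ hx hy => rw [mul_add]; exact add_mem hx hy
  | smul a x _ hx => rw [smul_eq_mul, mul_left_comm]; exact Ideal.mul_mem_left _ _ hx

end FrobeniusPowers

section Purity

theorem Ideal.ofList_map_pow_le {T : Type*} [CommRing T] {l : List T} {J : Ideal T}
    (h : ∀ x ∈ l, x ∈ J) (n : ℕ) :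
    ofList (l.map (· ^ n)) ≤ J ^ n := by
  refine span_le.2 fun x hx => ?_
  obtain ⟨a, ha, rfl⟩ := List.mem_map.1 hx
  exact pow_mem_pow (h a ha) n

theorem Ideal.prod_pow_mul_mem {T : Type*} [CommRing T] {l : List T} {x : T}
    (hx : x ∈ ofList l) (n : ℕ) :
    l.prod ^ n * x ∈ ofList (l.map (· ^ (n + 1))) := by
  induction hx using Submodule.span_induction with
  | mem x hx =>
    obtain ⟨w, hw⟩ := pow_dvd_pow_of_dvd (List.dvd_prod hx) n
    rw [hw, mul_right_comm, ← pow_succ]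
    exact Ideal.mul_mem_right _ _ (Ideal.subset_span (List.mem_map.2 ⟨x, hx, rfl⟩))
  | zero => simp
  | add x y _ _ hx hy => rw [mul_add]; exact add_mem hx hy
  | smul a x _ hx => rw [smul_eq_mul, mul_left_comm]; exact Ideal.mul_mem_left _ _ hx

variable {T : Type*} [CommRing T] [IsLocalRing T]

theorem IsParameterIdeal.map_pow {b : List T} (hb : IsParameterIdeal T (Ideal.ofList b))
    (hlen : (b.length : WithBot (WithTop ℕ)) = ringKrullDim T) {t : ℕ} (ht : t ≠ 0) :
    IsParameterIdeal T (Ideal.ofList (b.map (· ^ t))) := by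
  obtain ⟨-, -, -, hrad, -⟩ := hb
  refine ⟨b.length, fun i => b.get i ^ t, ?_, ?_, hlen⟩
  · unfold Ideal.ofList
    congr 1
    ext x
    constructor
    · intro h
      obtain ⟨z, hz, rfl⟩ := List.mem_map.1 h
      obtain ⟨i, rfl⟩ := List.mem_iff_get.1 hz
      exact ⟨i, rfl⟩
    · rintro ⟨i, rfl⟩
      exact List.mem_map.2 ⟨_, List.get_mem b i, rfl⟩
  · refine le_antisymm ?_ ?_
    · rw [← hrad]
      refine Ideal.radical_mono ((Ideal.ofList_map_pow_le (J := Ideal.ofList b)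
        (fun x hx => Ideal.subset_span hx) t).trans (Ideal.pow_le_self ht))
    · rw [← hrad, Ideal.radical_le_radical_iff]
      exact Ideal.span_le.2 fun x hx => ⟨t, Ideal.subset_span (List.mem_map.2 ⟨x, hx, rfl⟩)⟩

theorem exists_pow_le_of_radical_eq [IsNoetherianRing T] {I : Ideal T}
    (hI : I.radical = maximalIdeal T) : ∃ N, maximalIdeal T ^ N ≤ I := by
  rw [← hI]
  exact Ideal.exists_radical_pow_le_of_fg I ((isNoetherianRing_iff_ideal_fg T).1 ‹_› _)

theorem IsSocleGenerator.mem_iff {I : Ideal T} {y : T} (hy : IsSocleGenerator I y) {u : T} :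
    (∀ x ∈ maximalIdeal T, x * u ∈ I) ↔ u ∈ I ⊔ Ideal.span {y} := by
  rw [← hy.2, Submodule.mem_colon]
  refine forall₂_congr fun x _ => ?_
  rw [smul_eq_mul, mul_comm]

theorem IsSocleGenerator.mul_mem {I : Ideal T} {y : T} (hy : IsSocleGenerator I y) {x : T}
    (hx : x ∈ maximalIdeal T) : x * y ∈ I :=
  hy.mem_iff.2 (Ideal.mem_sup_right (Ideal.mem_span_singleton_self y)) x hx

theorem IsSocleGenerator.exists_mul_notMem [IsNoetherianRing T] {I : Ideal T} {y : T}
    (hy : IsSocleGenerator I y) (hI : I.radical = maximalIdeal T) {J : Ideal T} (hIJ : I ≤ J)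
    {u : T} (hu : u ∉ J) : ∃ k, (∀ j ∈ J, k * j ∈ I) ∧ k * u ∉ I := by
  obtain ⟨N, hN⟩ := exists_pow_le_of_radical_eq hI
  have hIM : I ≤ maximalIdeal T := hI ▸ Ideal.le_radical
  have : Nontrivial (T ⧸ I) := Ideal.Quotient.nontrivial_iff.2 fun h =>
    (maximalIdeal.isMaximal T).ne_top (top_le_iff.1 (h ▸ hIM))
  have : IsLocalRing (T ⧸ I) := .of_surjective' _ Ideal.Quotient.mk_surjective
  have hmax : ∀ x : T, Ideal.Quotient.mk I x ∈ maximalIdeal (T ⧸ I) ↔ x ∈ maximalIdeal T := by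
    intro x
    constructor
    · intro h
      by_contra hx
      exact (mem_maximalIdeal _).1 h ((notMem_maximalIdeal.1 hx).map _)
    · intro h
      rw [mem_maximalIdeal, mem_nonunits_iff]
      intro hux
      obtain ⟨w, hw⟩ := hux.exists_right_inv
      obtain ⟨w, rfl⟩ := Ideal.Quotient.mk_surjective w
      rw [← map_mul, ← map_one (Ideal.Quotient.mk I), Ideal.Quotient.eq] at hw
      refine (maximalIdeal.isMaximal T).ne_top ((Ideal.eq_top_iff_one _).2 ?_)
      convert sub_mem (Ideal.mul_mem_right w _ h) (hIM hw) using 1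
      ring
  have : IsArtinianRing (T ⧸ I) := by
    rw [isArtinianRing_iff_isNilpotent_maximalIdeal]
    refine ⟨N, ?_⟩
    have : maximalIdeal (T ⧸ I) ≤ (maximalIdeal T).map (Ideal.Quotient.mk I) := by
      intro x hx
      obtain ⟨x, rfl⟩ := Ideal.Quotient.mk_surjective x
      exact Ideal.mem_map_of_mem _ ((hmax x).1 hx)
    rw [Ideal.zero_eq_bot, ← le_bot_iff]
    refine (Ideal.pow_right_mono this N).trans ?_
    rw [← Ideal.map_pow, ← Ideal.map_quotient_self I]
    exact Ideal.map_mono hN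
  have hB : HasCyclicSocle (T ⧸ I) := by
    refine ⟨Ideal.Quotient.mk I y, ?_, ?_⟩
    · intro x hx
      obtain ⟨x, rfl⟩ := Ideal.Quotient.mk_surjective x
      rw [← map_mul, Ideal.Quotient.eq_zero_iff_mem]
      exact hy.mul_mem ((hmax x).1 hx)
    · intro v hv
      obtain ⟨v, rfl⟩ := Ideal.Quotient.mk_surjective v
      obtain ⟨t, ht⟩ := Ideal.mem_sup_span.1 (hy.mem_iff.1 fun x hx => by
        rw [← Ideal.Quotient.eq_zero_iff_mem, map_mul]
        exact hv _ ((hmax x).2 hx))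
      refine Ideal.mem_span_singleton.2 ⟨Ideal.Quotient.mk I t, ?_⟩
      rw [← map_mul, Ideal.Quotient.eq]
      exact ht
  obtain ⟨k, hk, hku⟩ := hB.exists_mul_ne_zero (J := J.map (Ideal.Quotient.mk I))
    (u := Ideal.Quotient.mk I u) (by
      intro h
      obtain ⟨j, hj, hju⟩ := (Ideal.mem_map_iff_of_surjective _ Ideal.Quotient.mk_surjective).1 h
      have := sub_mem hj (hIJ (Ideal.Quotient.eq.1 hju))
      rw [sub_sub_cancel] at this
      exact hu this)
  obtain ⟨k, rfl⟩ := Ideal.Quotient.mk_surjective k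
  refine ⟨k, fun j hj => ?_, fun h => hku ?_⟩
  · rw [← Ideal.Quotient.eq_zero_iff_mem, map_mul]
    exact hk _ (Ideal.mem_map_of_mem _ hj)
  · rw [← map_mul]
    exact Ideal.Quotient.eq_zero_iff_mem.2 h

theorem IsSocleGenerator.sup_le [IsNoetherianRing T] {I : Ideal T} {y : T}
    (hy : IsSocleGenerator I y) (hI : I.radical = maximalIdeal T) {v : T} (hv : v ∉ I) :
    I ⊔ Ideal.span {y} ≤ I ⊔ Ideal.span {v} := by
  classical
  obtain ⟨N, hN⟩ := exists_pow_le_of_radical_eq hI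
  have hex : ∃ n, ∀ x ∈ maximalIdeal T ^ n, x * v ∈ I :=
    ⟨N, fun x hx => I.mul_mem_right _ (hN hx)⟩
  obtain ⟨m, hm⟩ : ∃ m, Nat.find hex = m + 1 := Nat.exists_eq_succ_of_ne_zero fun h => hv (by
    have h' := Nat.find_spec hex
    rw [h] at h'
    rw [← one_mul v]
    exact h' 1 (by simp))
  have h1 := Nat.find_spec hex
  have h2 := Nat.find_min hex (m := m) (by omega)
  rw [hm] at h1
  push Not at h2
  obtain ⟨w, hw, hwv⟩ := h2
  obtain ⟨a, ha⟩ := Ideal.mem_sup_span.1 ((hy.mem_iff (u := w * v)).1 fun x hx => by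
    rw [← mul_assoc]
    exact h1 _ (by rw [pow_succ']; exact Ideal.mul_mem_mul hx hw))
  have hau : IsUnit a := by
    by_contra hau
    apply hwv
    convert add_mem ha (hy.mul_mem ((mem_maximalIdeal a).2 hau)) using 1
    ring
  obtain ⟨a', ha'⟩ := hau.exists_left_inv
  refine _root_.sup_le le_sup_left ?_
  rw [Ideal.span_singleton_le_iff_mem, Ideal.mem_sup_span]
  refine ⟨a' * w, ?_⟩
  rw [← neg_mem_iff]
  convert I.mul_mem_left a' ha using 1
  linear_combination (y) * ha'

/-- A Gorenstein local ring in which `c * y ^ q ∉ I ^ [q]` is pure along `1 ↦ c ^ (1/q)`. -/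
theorem mem_of_mul_pow_mem_frobPow [IsNoetherianRing T] [IsAdicComplete (maximalIdeal T) T]
    {p : ℕ} [ExpChar T p] (hGor : IsGorensteinLocal T) {I : Ideal T} (hI : IsParameterIdeal T I)
    {y : T} (hy : IsSocleGenerator I y) {c : T} {e : ℕ} (hc : c * y ^ p ^ e ∉ I.frobPow (p ^ e))
    {J : Ideal T} {u : T} (hu : c * u ^ p ^ e ∈ J.frobPow (p ^ e)) : u ∈ J := by
  by_contra huJ
  obtain ⟨⟨rs, hrsM, hrs, hrsl⟩, hsoc⟩ := hGor
  obtain ⟨n, x, hIx, hIrad, hn⟩ := id hI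
  have hlen : rs.length = n := by
    have := hrsl.trans hn.symm
    exact_mod_cast this
  have hdepth : Ideal.HasDepth (⊥ : Ideal T) (List.ofFn x).length := by
    rw [List.length_ofFn, ← hlen]
    exact (Ideal.IsRegularChain.of_isRegular hrs).hasDepth hrsM
  have hIx' : (⊥ : Ideal T) ⊔ Ideal.ofList (List.ofFn x) = I := by
    rw [bot_sup_eq, hIx]
    unfold Ideal.ofList
    congr 1
    ext t
    simp [List.mem_ofFn]
  obtain ⟨N, hN⟩ := exists_pow_le_of_radical_eq hIrad
  have hIM : I ≤ maximalIdeal T := hIrad ▸ Ideal.le_radical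
  obtain ⟨b, hbl, hbM, hb, hbI⟩ := hdepth.exists_isRegularChain (N := N) (by rwa [hIx'])
    (by rwa [hIx'])
  rw [hIx', bot_sup_eq] at hbI
  rw [List.length_ofFn] at hbl
  obtain ⟨n₀, hn₀⟩ : ∃ n₀, u ∉ J ⊔ maximalIdeal T ^ n₀ := by
    by_contra! h
    exact huJ (Ideal.mem_of_forall_mem_sup_pow h)
  set It := Ideal.ofList (b.map (· ^ (n₀ + 1))) with hIt
  have hItp : IsParameterIdeal T It := IsParameterIdeal.map_pow (hbI ▸ hI) (hbl ▸ hn) (by omega)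
  obtain ⟨yt, hyt⟩ := hsoc It hItp
  obtain ⟨-, -, -, hItrad, -⟩ := hItp
  have hItM : It ≤ maximalIdeal T ^ n₀ :=
    (Ideal.ofList_map_pow_le hbM _).trans (Ideal.pow_le_pow_right (Nat.le_succ _))
  obtain ⟨k, hkJ, hku⟩ := hyt.exists_mul_notMem hItrad (le_sup_right : It ≤ J ⊔ It) (u := u)
    (fun h => hn₀ (sup_le_sup_left hItM J h))
  obtain ⟨a, ha⟩ := Ideal.mem_sup_span.1 (hyt.sup_le hItrad hku ((hyt.mem_iff
    (u := b.prod ^ n₀ * y)).1 fun x hx => by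
      rw [mul_left_comm]
      exact Ideal.prod_pow_mul_mem (hbI ▸ hy.mul_mem hx) n₀))
  set i := b.prod ^ n₀ * y - k * u * a with hi
  have h1 : (b.prod ^ n₀ * y) ^ p ^ e = i ^ p ^ e + (k * u * a) ^ p ^ e := by
    rw [← add_pow_expChar_pow, hi]
    ring
  have h2 : c * (b.prod ^ n₀ * y) ^ p ^ e ∈ It.frobPow (p ^ e) := by
    rw [h1, mul_add]
    refine add_mem (Ideal.mul_mem_left _ _ (Ideal.subset_span ⟨i, ha, rfl⟩)) ?_
    have := Ideal.pow_mul_mem_frobPow (fun j hj => hkJ j (Ideal.mem_sup_left hj)) hu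
    convert Ideal.mul_mem_right (a ^ p ^ e) _ this using 1
    ring
  refine hc ?_
  rw [← hbI, Ideal.frobPow_ofList]
  rw [hIt, Ideal.frobPow_ofList, List.map_map] at h2
  have h3 := hb.mem_of_mul_prod_pow_mem (p ^ e) (n₀ * p ^ e) (u := c * y ^ p ^ e) (by
    rw [bot_sup_eq]
    convert h2 using 1
    · congr 2
      funext z
      simp only [Function.comp]
      ring
    · ring)
  rwa [bot_sup_eq] at h3

end Purity

section GoodSubrings

variable {T : Type*} [CommRing T]

/-- Subrings of `T` that meet `P` and the zero divisors trivially, are closed under division in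
`T`, and in which greatest common divisors exist and stay coprime in `T`. -/
structure IsGoodSubring (P : Ideal T) (R : Subring T) : Prop where
  reg : ∀ a ∈ R, a ≠ 0 → ∀ t, a * t = 0 → t = 0
  notMem : ∀ a ∈ R, a ∈ P → a = 0
  closed : ∀ a ∈ R, a ≠ 0 → ∀ t, a * t ∈ R → t ∈ R
  gcd : ∀ a ∈ R, a ≠ 0 → ∀ b ∈ R, ∃ h ∈ R, ∃ a' ∈ R, ∃ b' ∈ R,
    a = h * a' ∧ b = h * b' ∧ (Ideal.span {a'}).IsRegularMod b'

/-- The primes at which transcendental elements have to be chosen generically. -/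
def controlledPrimes (P : Ideal T) (R : Subring T) : Set (Ideal T) :=
  insert P {Q | ∃ r ∈ R, (Ideal.span {r}).IsAssPrime Q}

namespace IsGoodSubring

variable {P : Ideal T} {R : Subring T}

/-- Two elements of `R` in an associated prime of a nonzero principal ideal have a common divisor
there. -/
theorem exists_common_divisor (hR : IsGoodSubring P R) {Q : Ideal T} {r : T} (hr : r ∈ R)
    (hr0 : r ≠ 0) (hQ : (Ideal.span {r}).IsAssPrime Q) {a b : T} (ha : a ∈ R) (ha0 : a ≠ 0)
    (hb : b ∈ R) (haQ : a ∈ Q) (hbQ : b ∈ Q) :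
    ∃ h ∈ R, h ∈ Q ∧ h ∣ a ∧ h ∣ b := by
  obtain ⟨h, hh, a', ha', b', hb', rfl, rfl, hab⟩ := hR.gcd a ha ha0 b hb
  by_cases hhQ : h ∈ Q
  · exact ⟨h, hh, hhQ, dvd_mul_right _ _, dvd_mul_right _ _⟩
  · have ha'Q := (hQ.1.mem_or_mem haQ).resolve_left hhQ
    have hb'Q := (hQ.1.mem_or_mem hbQ).resolve_left hhQ
    have := hQ.of_mem (hR.reg r hr hr0) (hR.reg a' ha' (right_ne_zero_of_mul ha0)) ha'Q
    exact (this.not_isRegularMod hb'Q hab).elim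

/-- `h` generates the contraction of some prime of `T` to `R`. -/
def _root_.IsContractionGenerator (R : Subring T) (h : T) (Q : Ideal T) : Prop :=
  h ∈ R ∧ h ≠ 0 ∧ Q.IsPrime ∧ ∀ a ∈ R, a ∈ Q ↔ h ∣ a

theorem exists_isContractionGenerator [IsNoetherianRing T] (hR : IsGoodSubring P R) {Q : Ideal T}
    {r : T} (hr : r ∈ R) (hr0 : r ≠ 0) (hQ : (Ideal.span {r}).IsAssPrime Q) :
    ∃ h, IsContractionGenerator R h Q := by
  have hrQ : r ∈ Q := hQ.le (Ideal.mem_span_singleton_self r)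
  obtain ⟨-, ⟨h, ⟨hh, hh0, hhQ⟩, rfl⟩, hmax⟩ := set_has_maximal_iff_noetherian.2
    (inferInstanceAs (IsNoetherian T T))
    ((fun h => Ideal.span {h}) '' {h | h ∈ R ∧ h ≠ 0 ∧ h ∈ Q}) ⟨_, r, ⟨hr, hr0, hrQ⟩, rfl⟩
  refine ⟨h, hh, hh0, hQ.1, fun a ha => ⟨fun haQ => ?_, fun had => Q.mem_of_dvd had hhQ⟩⟩
  obtain ⟨g, hg, hgQ, hgh, hga⟩ := hR.exists_common_divisor hr hr0 hQ hh hh0 ha hhQ haQ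
  have hg0 : g ≠ 0 := fun h0 => hh0 (by rw [h0] at hgh; exact zero_dvd_iff.1 hgh)
  have hle : Ideal.span {h} ≤ Ideal.span {g} := Ideal.span_singleton_le_span_singleton.2 hgh
  have heq := (lt_or_eq_of_le hle).resolve_left (hmax _ ⟨g, ⟨hg, hg0, hgQ⟩, rfl⟩)
  exact (Ideal.span_singleton_le_span_singleton.1 heq.ge).trans hga

theorem IsContractionGenerator.mem_iff [IsNoetherianRing T] (hR : IsGoodSubring P R) {h : T}
    {Q Q' : Ideal T} (hh : IsContractionGenerator R h Q) (hQ' : (Ideal.span {h}).IsAssPrime Q') :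
    IsContractionGenerator R h Q' := by
  obtain ⟨hhR, hh0, hQ, hiff⟩ := hh
  obtain ⟨g, hgR, hg0, -, hg⟩ := hR.exists_isContractionGenerator hhR hh0 hQ'
  have hhQ' : h ∈ Q' := hQ'.le (Ideal.mem_span_singleton_self h)
  have hgQ' : g ∈ Q' := (hg g hgR).2 dvd_rfl
  refine ⟨hhR, hh0, hQ'.1, fun a ha => ⟨fun haQ => ?_, fun had => Q'.mem_of_dvd had hhQ'⟩⟩
  obtain ⟨x, rfl⟩ := (hg h hhR).1 hhQ'
  have hx : x ∈ R := hR.closed g hgR hg0 x hhR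
  rcases hQ.mem_or_mem ((hiff _ hhR).2 dvd_rfl) with h1 | h1
  · exact ((hiff g hgR).1 h1).trans ((hg a ha).1 haQ)
  · obtain ⟨z, hz⟩ := (hiff x hx).1 h1
    have : 1 - g * z = 0 := hR.reg x hx (right_ne_zero_of_mul hh0) _ (by linear_combination hz)
    refine (hQ'.1.ne_top ((Ideal.eq_top_iff_one _).2 ?_)).elim
    rw [sub_eq_zero.1 this]
    exact Q'.mul_mem_right _ hgQ'

theorem isPrime_of_mem (hP : P.IsPrime) {Q : Ideal T} (hQ : Q ∈ controlledPrimes P R) :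
    Q.IsPrime := by
  rcases hQ with rfl | ⟨r, -, hQ⟩
  exacts [hP, hQ.1]

/-- The contraction to `R` of a controlled prime is zero or principal. -/
theorem controlled_cases [IsNoetherianRing T] (hR : IsGoodSubring P R) {Q : Ideal T}
    (hQ : Q ∈ controlledPrimes P R) :
    (∀ a ∈ R, a ∈ Q → a = 0) ∨ ∃ h, IsContractionGenerator R h Q := by
  rcases hQ with rfl | ⟨r, hr, hQ⟩
  · exact Or.inl hR.notMem
  · by_cases hr0 : r = 0
    · left
      intro a ha haQ
      by_contra ha0
      refine hQ.not_isRegularMod haQ fun t ht => ?_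
      rw [hr0, Ideal.span_singleton_eq_bot.2 rfl, Ideal.mem_bot] at ht ⊢
      exact hR.reg a ha ha0 t ht
    · exact Or.inr (hR.exists_isContractionGenerator hr hr0 hQ)

theorem IsContractionGenerator.mem {h : T} {Q : Ideal T} (hh : IsContractionGenerator R h Q) :
    h ∈ Q := (hh.2.2.2 h hh.1).2 dvd_rfl

theorem notMem_or_notMem (hR : IsGoodSubring P R) {d v : T} (hd : d ∈ R)
    (hd0 : d ≠ 0) (hdv : (Ideal.span {d}).IsRegularMod v) {Q : Ideal T}
    (hQ : Q ∈ controlledPrimes P R) : d ∉ Q ∨ v ∉ Q := by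
  by_contra! hc
  rcases hQ with rfl | ⟨r, hr, hQ⟩
  · exact hd0 (hR.notMem d hd hc.1)
  · by_cases hr0 : r = 0
    · refine hQ.not_isRegularMod hc.1 fun t ht => ?_
      rw [hr0, Ideal.span_singleton_eq_bot.2 rfl, Ideal.mem_bot] at ht ⊢
      exact hR.reg d hd hd0 t ht
    · exact (hQ.of_mem (hR.reg r hr hr0) (hR.reg d hd hd0) hc.1).not_isRegularMod hc.2 hdv

variable [IsLocalRing T]

/-- A list of elements of a division-closed subring can be divided by a common factor so that no
common nonunit factor remains. -/
theorem exists_stripped (hclosed : ∀ a ∈ R, a ≠ 0 → ∀ t, a * t ∈ R → t ∈ R) (n : ℕ)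
    (l : List T) (hl : ∀ y ∈ l, y ∈ R) (hn : ∃ y ∈ l, y ∉ maximalIdeal T ^ n) :
    ∃ δ ∈ R, ∃ l' : List T, l = l'.map (δ * ·) ∧ (∀ y ∈ l', y ∈ R) ∧
      ∀ h ∈ R, h ∈ maximalIdeal T → ¬ ∀ y ∈ l', h ∣ y := by
  induction n generalizing l with
  | zero => simp at hn
  | succ n ih =>
    by_cases hs : ∀ h ∈ R, h ∈ maximalIdeal T → ¬ ∀ y ∈ l, h ∣ y
    · exact ⟨1, R.one_mem, l, by simp, hl, hs⟩
    push Not at hs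
    obtain ⟨h, hh, hhM, hdvd⟩ := hs
    choose! q hq using hdvd
    have hl' : l = (l.map q).map (h * ·) := by
      rw [List.map_map]
      conv_lhs => rw [← List.map_id l]
      exact List.map_congr_left fun y hy => hq y hy
    obtain ⟨y, hy, hyn⟩ := hn
    have hh0 : h ≠ 0 := by
      rintro rfl
      refine hyn ?_
      rw [hq y hy, zero_mul]
      exact zero_mem _
    obtain ⟨δ, hδ, l'', he, hl'', hs⟩ := ih (l.map q)
      (fun z hz => by
        obtain ⟨w, hw, rfl⟩ := List.mem_map.1 hz
        exact hclosed h hh hh0 _ (by rw [← hq w hw]; exact hl w hw))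
      ⟨q y, List.mem_map.2 ⟨y, hy, rfl⟩, fun hmem => hyn (by
        rw [hq y hy, pow_succ']
        exact Ideal.mul_mem_mul hhM hmem)⟩
    refine ⟨h * δ, R.mul_mem hh hδ, l'', ?_, hl'', hs⟩
    rw [hl', he, List.map_map]
    exact List.map_congr_left fun y _ => by simp [mul_assoc]

theorem exists_notMem_pow [IsNoetherianRing T] {a : T} (ha : a ≠ 0) :
    ∃ n, a ∉ maximalIdeal T ^ n := by
  by_contra! h
  exact ha (Ideal.mem_bot.1 (Ideal.mem_of_forall_mem_sup_pow fun n => Ideal.mem_sup_right (h n)))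

end IsGoodSubring

section FractionClosure

/-- The elements of `T` that are fractions of elements of the subring `U` with regular
denominator. -/
def fractionClosure (U : Subring T) : Subring T where
  carrier := {t | ∃ b ∈ U, (∀ s, b * s = 0 → s = 0) ∧ b * t ∈ U}
  mul_mem' := by
    rintro x y ⟨b, hb, hbr, hx⟩ ⟨c, hc, hcr, hy⟩
    refine ⟨b * c, U.mul_mem hb hc, fun s hs => hcr s (hbr _ (by rwa [← mul_assoc])), ?_⟩
    rw [mul_mul_mul_comm]
    exact U.mul_mem hx hy
  one_mem' := ⟨1, U.one_mem, fun s hs => by simpa using hs, by simp⟩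
  add_mem' := by
    rintro x y ⟨b, hb, hbr, hx⟩ ⟨c, hc, hcr, hy⟩
    refine ⟨b * c, U.mul_mem hb hc, fun s hs => hcr s (hbr _ (by rwa [← mul_assoc])), ?_⟩
    have : b * c * (x + y) = c * (b * x) + b * (c * y) := by ring
    rw [this]
    exact U.add_mem (U.mul_mem hc hx) (U.mul_mem hb hy)
  zero_mem' := ⟨1, U.one_mem, fun s hs => by simpa using hs, by simp⟩
  neg_mem' := by
    rintro x ⟨b, hb, hbr, hx⟩
    exact ⟨b, hb, hbr, by rw [mul_neg]; exact U.neg_mem hx⟩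

theorem le_fractionClosure (U : Subring T) : U ≤ fractionClosure U := fun t ht =>
  ⟨1, U.one_mem, fun s hs => by simpa using hs, by simpa using ht⟩

theorem fractionClosure_le {U V : Subring T} (h : U ≤ fractionClosure V) :
    fractionClosure U ≤ fractionClosure V := by
  rintro t ⟨b, hb, hbr, ht⟩
  obtain ⟨c, hc, hcr, hcb⟩ := h hb
  obtain ⟨d, hd, hdr, hdt⟩ := h ht
  refine ⟨d * (c * b), V.mul_mem hd hcb,
    fun s hs => hbr s (hcr _ (hdr _ (by rw [← hs]; ring))), ?_⟩
  have : d * (c * b) * t = c * (d * (b * t)) := by ring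
  rw [this]
  exact V.mul_mem hc hdt

/-- The subring `R[g]` of `T`. -/
noncomputable def adjoinElement (R : Subring T) (g : T) : Subring T :=
  (Polynomial.eval₂RingHom R.subtype g).range

theorem mem_adjoinElement {R : Subring T} {g x : T} :
    x ∈ adjoinElement R g ↔ ∃ F : Polynomial R, F.eval₂ R.subtype g = x := Iff.rfl

theorem le_adjoinElement (R : Subring T) (g : T) : R ≤ adjoinElement R g := fun x hx =>
  mem_adjoinElement.2 ⟨Polynomial.C ⟨x, hx⟩, by simp⟩

theorem self_mem_adjoinElement (R : Subring T) (g : T) : g ∈ adjoinElement R g :=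
  mem_adjoinElement.2 ⟨Polynomial.X, by simp⟩

theorem adjoinElement_le {R U : Subring T} {g : T} (hR : R ≤ U) (hg : g ∈ U) :
    adjoinElement R g ≤ U := by
  intro x hx
  obtain ⟨F, rfl⟩ := mem_adjoinElement.1 hx
  rw [Polynomial.eval₂_eq_sum_range]
  exact U.sum_mem fun i _ => U.mul_mem (hR (F.coeff i).2) (U.pow_mem hg i)

end FractionClosure

end GoodSubrings

section Generic

open Cardinal Polynomial

variable {T : Type u} [CommRing T]

/-- `g` is transcendental over `R` modulo `Q`. -/
def IsGenericAt (R : Subring T) (g : T) (Q : Ideal T) : Prop :=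
  ∀ F : R[X], F.eval₂ R.subtype g ∈ Q → ∀ n, (F.coeff n : T) ∈ Q

theorem finite_setOf_eval_add_mul_eq_zero {D : Type*} [CommRing D] [IsDomain D] {F : D[X]}
    (hF : F ≠ 0) {b : D} (hb : b ≠ 0) (a : D) : {x : D | F.eval (a + x * b) = 0}.Finite := by
  classical
  refine Set.Finite.of_finite_image (f := fun x => a + x * b)
    (F.roots.toFinset.finite_toSet.subset ?_) ?_
  · rintro _ ⟨x, hx, rfl⟩
    simpa [hF] using hx
  · intro x _ y _ h
    exact mul_right_cancel₀ hb (add_left_cancel h)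

theorem mk_controlledPrimes_le [IsNoetherianRing T] (P : Ideal T) (R : Subring T) :
    #(controlledPrimes P R) ≤ max ℵ₀ #R := by
  have h : {Q | ∃ r ∈ R, (Ideal.span {r}).IsAssPrime Q}
      = ⋃ r : R, {Q | (Ideal.span {(r : T)}).IsAssPrime Q} := by
    ext Q; simp
  refine (mk_insert_le).trans ?_
  rw [h]
  refine add_le_of_le (le_max_left _ _) ?_ (one_le_aleph0.trans (le_max_left _ _))
  refine (mk_iUnion_le _).trans (mul_le_of_le (le_max_left _ _) (le_max_right _ _) ?_)
  refine (ciSup_le' fun r => ?_).trans (le_max_left _ _)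
  exact (Ideal.finite_isAssPrime _).lt_aleph0.le

theorem eval_map_mk {R : Subring T} (Q : Ideal T) (F : R[X]) (g : T) :
    (F.map ((Ideal.Quotient.mk Q).comp R.subtype)).eval (Ideal.Quotient.mk Q g)
      = Ideal.Quotient.mk Q (F.eval₂ R.subtype g) := by
  rw [eval_map, hom_eval₂]

variable [IsLocalRing T] [IsNoetherianRing T] [IsAdicComplete (maximalIdeal T) T]

theorem exists_isGenericAt {P : Ideal T} (hP : P.IsPrime) {R : Subring T}
    (hcard : #R < #(ℕ → ResidueField T)) (hM : ∀ Q ∈ controlledPrimes P R, Q ≠ maximalIdeal T)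
    {J : Ideal T} (hJ : ∀ Q ∈ controlledPrimes P R, ¬ J ≤ Q) (t₁ t₂ v d : T) :
    ∃ s ∈ J, ∀ Q ∈ controlledPrimes P R, (v ∉ Q → IsGenericAt R (t₁ + s * v) Q) ∧
      (d ∉ Q → IsGenericAt R (t₂ - s * d) Q) := by
  have hmax : max ℵ₀ #R < #(ℕ → ResidueField T) := max_lt (aleph0_lt_mk_residue_seq T) hcard
  have hι : #(controlledPrimes P R × R[X]) < #(ℕ → ResidueField T) := by
    refine lt_of_le_of_lt ?_ hmax
    rw [mk_prod, lift_id, lift_id]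
    refine mul_le_of_le (le_max_left _ _) (mk_controlledPrimes_le P R) ?_
    exact cardinalMk_le_max.trans (max_comm _ _).le
  have hpr (i : controlledPrimes P R × R[X]) : (i.1 : Ideal T).IsPrime :=
    IsGoodSubring.isPrime_of_mem hP i.1.2
  obtain ⟨s, hs, hav⟩ := exists_mem_avoiding hι (fun i => i.1) hpr (fun i => hM _ i.1.2)
    (fun i => {x | i.2.map ((Ideal.Quotient.mk (i.1 : Ideal T)).comp R.subtype) ≠ 0 ∧
      ((v ∉ (i.1 : Ideal T) ∧
        (i.2.map ((Ideal.Quotient.mk (i.1 : Ideal T)).comp R.subtype)).eval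
          (Ideal.Quotient.mk (i.1 : Ideal T) t₁ + x * Ideal.Quotient.mk (i.1 : Ideal T) v) = 0) ∨
       (d ∉ (i.1 : Ideal T) ∧
        (i.2.map ((Ideal.Quotient.mk (i.1 : Ideal T)).comp R.subtype)).eval
          (Ideal.Quotient.mk (i.1 : Ideal T) t₂ + x * Ideal.Quotient.mk (i.1 : Ideal T) (-d))
            = 0))})
    (fun i => by
      have := hpr i
      by_cases hF : i.2.map ((Ideal.Quotient.mk (i.1 : Ideal T)).comp R.subtype) = 0
      · simp [hF]
      have hfin {w : T} (hw : w ∉ (i.1 : Ideal T)) (t : T) :=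
        finite_setOf_eval_add_mul_eq_zero hF
          (b := Ideal.Quotient.mk (i.1 : Ideal T) w)
          (by rwa [Ne, Ideal.Quotient.eq_zero_iff_mem]) (Ideal.Quotient.mk (i.1 : Ideal T) t)
      by_cases hv : v ∈ (i.1 : Ideal T) <;> by_cases hd : d ∈ (i.1 : Ideal T)
      · simp [hv, hd]
      · exact (hfin (w := -d) (by simpa using hd) t₂).subset fun x hx => by
          rcases hx.2 with h | h
          exacts [(h.1 hv).elim, h.2]
      · exact (hfin hv t₁).subset fun x hx => by
          rcases hx.2 with h | h
          exacts [h.2, (h.1 hd).elim]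
      · exact ((hfin hv t₁).union (hfin (w := -d) (by simpa using hd) t₂)).subset fun x hx => by
          rcases hx.2 with h | h
          exacts [Or.inl h.2, Or.inr h.2]) J (fun i => hJ _ i.1.2)
  have key (Q : Ideal T) (F : R[X]) (hF : ¬ ∀ n, (F.coeff n : T) ∈ Q) :
      F.map ((Ideal.Quotient.mk Q).comp R.subtype) ≠ 0 := by
    refine fun h0 => hF fun n => ?_
    have := congrArg (fun G => G.coeff n) h0
    simpa [Ideal.Quotient.eq_zero_iff_mem] using this
  refine ⟨s, hs, fun Q hQ => ⟨fun hv F hFQ => ?_, fun hd F hFQ => ?_⟩⟩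
  · by_contra hF
    refine hav ⟨⟨Q, hQ⟩, F⟩ ⟨key Q F hF, Or.inl ⟨hv, ?_⟩⟩
    rw [← map_mul, ← map_add, eval_map_mk]
    exact Ideal.Quotient.eq_zero_iff_mem.2 hFQ
  · by_contra hF
    refine hav ⟨⟨Q, hQ⟩, F⟩ ⟨key Q F hF, Or.inr ⟨hd, ?_⟩⟩
    rw [← map_mul, ← map_add, eval_map_mk, mul_neg, ← sub_eq_add_neg]
    exact Ideal.Quotient.eq_zero_iff_mem.2 hFQ

end Generic

section GenericExtension

open Polynomial

/-- Bézout's identity for polynomials over a domain, with denominators cleared. -/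
theorem Polynomial.exists_coprime_ratio {R : Type*} [CommRing R] [IsDomain R] {A : R[X]}
    (hA : A ≠ 0) (B : R[X]) : ∃ F G V W : R[X], ∃ r : R, r ≠ 0 ∧ A * G = B * F ∧
      V * F + W * G = C r ∧ F ≠ 0 := by
  classical
  let K := FractionRing R
  have hinj : Function.Injective (algebraMap R K) := IsFractionRing.injective R K
  have clear (q : K[X]) : ∃ b : R, b ≠ 0 ∧ ∃ q' : R[X], q'.map (algebraMap R K)
      = C (algebraMap R K b) * q := by
    obtain ⟨b, hb, h⟩ := IsLocalization.integerNormalization_spec (nonZeroDivisors R) q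
    exact ⟨b, nonZeroDivisors.ne_zero hb, _, by
      rw [h, ← IsScalarTower.algebraMap_smul K b q, smul_eq_C_mul]⟩
  set a := A.map (algebraMap R K) with ha
  set b := B.map (algebraMap R K) with hb
  have ha0 : a ≠ 0 := (Polynomial.map_ne_zero_iff hinj).2 hA
  obtain ⟨f, hf⟩ := EuclideanDomain.gcd_dvd_left a b
  obtain ⟨g, hg⟩ := EuclideanDomain.gcd_dvd_right a b
  have hD := EuclideanDomain.gcd_eq_gcd_ab a b
  set D := EuclideanDomain.gcd a b
  have hD0 : D ≠ 0 := fun h => ha0 (by rw [hf, h, zero_mul])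
  have hf0 : f ≠ 0 := fun h => ha0 (by rw [hf, h, mul_zero])
  set v := EuclideanDomain.gcdA a b
  set w := EuclideanDomain.gcdB a b
  have hvw : v * f + w * g = 1 := by
    apply mul_left_cancel₀ hD0
    rw [mul_one]
    conv_rhs => rw [hD]
    linear_combination (-v) * hf - w * hg
  obtain ⟨r₁, h₁, F, hF⟩ := clear f
  obtain ⟨r₂, h₂, G, hG⟩ := clear g
  obtain ⟨r₃, h₃, V, hV⟩ := clear v
  obtain ⟨r₄, h₄, W, hW⟩ := clear w
  refine ⟨C r₂ * F, C r₁ * G, C r₄ * V, C r₃ * W, r₁ * r₂ * r₃ * r₄,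
    by simp [*], ?_, ?_, ?_⟩
  · apply Polynomial.map_injective _ hinj
    simp only [Polynomial.map_mul, map_C, hF, hG, ← ha, ← hb]
    linear_combination (C ((algebraMap R K) r₁) * (C ((algebraMap R K) r₂) * g)) * hf
      - (C ((algebraMap R K) r₁) * (C ((algebraMap R K) r₂) * f)) * hg
  · apply Polynomial.map_injective _ hinj
    simp only [Polynomial.map_mul, Polynomial.map_add, map_C, hF, hG, hV, hW, map_mul]
    linear_combination (C ((algebraMap R K) r₁) * C ((algebraMap R K) r₂) *
      C ((algebraMap R K) r₃) * C ((algebraMap R K) r₄)) * hvw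
  · refine mul_ne_zero (C_ne_zero.2 h₂) fun h => ?_
    rw [h, Polynomial.map_zero] at hF
    exact mul_ne_zero (C_ne_zero.2 ((map_ne_zero_iff _ hinj).2 h₁)) hf0 hF.symm

variable {T : Type u} [CommRing T]

/-- `S` is a simple transcendental extension of `R`, generically at every controlled prime;
the generator may depend on the contraction of the prime. -/
def IsGenericExtension (P : Ideal T) (R S : Subring T) : Prop :=
  ∀ Q ∈ controlledPrimes P R, ∃ g, S = fractionClosure (adjoinElement R g) ∧
    ∀ Q' ∈ controlledPrimes P R, (∀ a ∈ R, a ∈ Q' ↔ a ∈ Q) → IsGenericAt R g Q'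

theorem Ideal.IsAssPrime.mem_controlledPrimes {R : Subring T} {Q : Ideal T} {r : T}
    (hQ : (Ideal.span {r}).IsAssPrime Q) (hr : r ∈ R) (P : Ideal T) : Q ∈ controlledPrimes P R :=
  Or.inr ⟨r, hr, hQ⟩

theorem exists_isAssPrime_of_mul_eq_zero [IsNoetherianRing T] {a t : T} (h : a * t = 0)
    (ht : t ≠ 0) : ∃ Q, (Ideal.span {(0 : T)}).IsAssPrime Q ∧ a ∈ Q := by
  rw [Ideal.span_singleton_eq_bot.2 rfl]
  exact Ideal.exists_isAssPrime_of_mul_mem (J := ⊥) (Ideal.mem_bot.2 h) (by simpa using ht)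

theorem eval₂_mem_adjoinElement {R : Subring T} (F : R[X]) (g : T) :
    F.eval₂ R.subtype g ∈ adjoinElement R g := mem_adjoinElement.2 ⟨F, rfl⟩

namespace IsGenericExtension

variable {P : Ideal T} {R S : Subring T}

theorem le (h : IsGenericExtension P R S) : R ≤ S := by
  obtain ⟨g, rfl, -⟩ := h P (Or.inl rfl)
  exact (le_adjoinElement R g).trans (le_fractionClosure _)

theorem eq_zero_of_mem (h : IsGenericExtension P R S) {Q : Ideal T}
    (hQ : Q ∈ controlledPrimes P R) (hQ0 : ∀ a ∈ R, a ∈ Q → a = 0) {a : T} (ha : a ∈ S)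
    (haQ : a ∈ Q) : a = 0 := by
  obtain ⟨g, rfl, hg⟩ := h Q hQ
  obtain ⟨b, hb, hbr, hba⟩ := ha
  obtain ⟨F, hF⟩ := mem_adjoinElement.1 hba
  have hF0 : F = 0 := by
    ext n
    exact hQ0 _ (F.coeff n).2 (hg Q hQ (fun _ _ => Iff.rfl) F
      (by rw [hF]; exact Q.mul_mem_left _ haQ) n)
  rw [hF0, eval₂_zero] at hF
  exact hbr a hF.symm

variable [IsNoetherianRing T]

theorem reg (hR : IsGoodSubring P R) (h : IsGenericExtension P R S) {a : T} (ha : a ∈ S)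
    (ha0 : a ≠ 0) (t : T) (hat : a * t = 0) : t = 0 := by
  by_contra ht
  obtain ⟨Q, hQ, haQ⟩ := exists_isAssPrime_of_mul_eq_zero hat ht
  refine ha0 (h.eq_zero_of_mem (hQ.mem_controlledPrimes R.zero_mem P) (fun b hb hbQ => ?_) ha haQ)
  by_contra hb0
  refine hQ.not_isRegularMod hbQ fun s hs => ?_
  rw [Ideal.span_singleton_eq_bot.2 rfl, Ideal.mem_bot] at hs ⊢
  exact hR.reg b hb hb0 s hs

theorem closed (hR : IsGoodSubring P R) (h : IsGenericExtension P R S) {a : T} (ha : a ∈ S)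
    (ha0 : a ≠ 0) (t : T) (hat : a * t ∈ S) : t ∈ S := by
  have har := h.reg hR ha ha0
  obtain ⟨g, rfl, -⟩ := h P (Or.inl rfl)
  obtain ⟨b, hb, hbr, hba⟩ := ha
  obtain ⟨c, hc, hcr, hct⟩ := hat
  refine ⟨c * (b * a), Subring.mul_mem _ hc hba,
    fun s hs => har s (hbr _ (hcr _ (by rw [← hs]; ring))), ?_⟩
  have : c * (b * a) * t = b * (c * (a * t)) := by ring
  rw [this]
  exact Subring.mul_mem _ hb hct

variable [IsLocalRing T]

theorem dvd_of_mem (hR : IsGoodSubring P R) (h : IsGenericExtension P R S) {Q : Ideal T}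
    (hQ : Q ∈ controlledPrimes P R) {c : T} (hc : IsContractionGenerator R c Q) {a : T}
    (ha : a ∈ S) (haQ : a ∈ Q) : c ∣ a := by
  obtain ⟨g, rfl, hg⟩ := h Q hQ
  have hcr := hR.reg c hc.1 hc.2.1
  have dvd_iff (F : R[X]) : (∀ n, (F.coeff n : T) ∈ Q) →
      ∃ F' : R[X], F = C ⟨c, hc.1⟩ * F' := fun hF => by
    refine (C_dvd_iff_dvd_coeff _ _).2 fun n => ?_
    obtain ⟨z, hz⟩ := (hc.2.2.2 _ (F.coeff n).2).1 (hF n)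
    exact ⟨⟨z, hR.closed c hc.1 hc.2.1 z (by rw [← hz]; exact (F.coeff n).2)⟩, Subtype.ext hz⟩
  have key (n : ℕ) : ∀ G F : R[X], (∀ s, G.eval₂ R.subtype g * s = 0 → s = 0) →
      G.eval₂ R.subtype g * a = F.eval₂ R.subtype g →
      (∃ i, (G.coeff i : T) ∉ maximalIdeal T ^ n) → c ∣ a := by
    induction n with
    | zero => rintro G F - - ⟨i, hi⟩; simp at hi
    | succ n ih =>
      rintro G F hG hGF ⟨i, hi⟩
      obtain ⟨F', rfl⟩ := dvd_iff F (hg Q hQ (fun _ _ => Iff.rfl) F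
        (by rw [← hGF]; exact Q.mul_mem_left _ haQ))
      by_cases hGQ : ∀ n, (G.coeff n : T) ∈ Q
      · obtain ⟨G', rfl⟩ := dvd_iff G hGQ
        simp only [eval₂_mul, eval₂_C, Subring.subtype_apply] at hG hGF
        refine ih G' F' (fun s hs => hG s (by rw [mul_assoc, hs, mul_zero])) ?_ ⟨i, fun hm => ?_⟩
        · exact sub_eq_zero.1 (hcr _ (by linear_combination hGF))
        · rw [coeff_C_mul, Subring.coe_mul, pow_succ'] at hi
          exact hi (Ideal.mul_mem_mul
            (le_maximalIdeal hc.2.2.1.ne_top (IsGoodSubring.IsContractionGenerator.mem hc)) hm)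
      · have hreg : (Ideal.span {c}).IsRegularMod (G.eval₂ R.subtype g) := by
          refine Ideal.isRegularMod_of_forall_isAssPrime fun Q' hQ' hGQ' => hGQ fun n => ?_
          have hc' := IsGoodSubring.IsContractionGenerator.mem_iff hR hc hQ'
          have hiff : ∀ a ∈ R, a ∈ Q' ↔ a ∈ Q := fun a ha =>
            (hc'.2.2.2 a ha).trans (hc.2.2.2 a ha).symm
          exact (hiff _ (G.coeff n).2).1
            (hg Q' (hQ'.mem_controlledPrimes hc.1 P) hiff G hGQ' n)
        refine Ideal.mem_span_singleton.1 (hreg a ?_)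
        rw [hGF, eval₂_mul, eval₂_C]
        exact Ideal.mul_mem_right _ _ (Ideal.mem_span_singleton_self c)
  obtain ⟨b, hb, hbr, hba⟩ := ha
  obtain ⟨G, rfl⟩ := mem_adjoinElement.1 hb
  obtain ⟨F, hF⟩ := mem_adjoinElement.1 hba
  have hG0 : G ≠ 0 := by
    rintro rfl
    exact one_ne_zero (hbr 1 (by simp))
  obtain ⟨n, hn⟩ := IsGoodSubring.exists_notMem_pow (T := T)
    (a := G.leadingCoeff) (by simpa using hG0)
  exact key n G F hbr hF.symm ⟨G.natDegree, hn⟩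

theorem exists_gcd (hR : IsGoodSubring P R) (h : IsGenericExtension P R S) {a b : T}
    (ha : a ∈ S) (ha0 : a ≠ 0) (hb : b ∈ S) : ∃ e ∈ S, ∃ a' ∈ S, ∃ b' ∈ S,
      a = e * a' ∧ b = e * b' ∧ (Ideal.span {a'}).IsRegularMod b' := by
  have hreg {a : T} := h.reg hR (a := a)
  have hclosed {a : T} := h.closed hR (a := a)
  have : NoZeroDivisors R := ⟨fun {x y} hxy => by
    by_contra! hc
    exact hc.2 (Subtype.ext (hR.reg x x.2 (fun h0 => hc.1 (Subtype.ext h0)) y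
      (congrArg Subtype.val hxy)))⟩
  have : IsDomain R := NoZeroDivisors.to_isDomain R
  obtain ⟨g, hS, hg⟩ := h P (Or.inl rfl)
  have hgS (F : R[X]) : F.eval₂ R.subtype g ∈ S := by
    rw [hS]
    exact le_fractionClosure _ (eval₂_mem_adjoinElement F g)
  have hg0 (F : R[X]) (hF : F.eval₂ R.subtype g = 0) : F = 0 := by
    ext n
    exact hR.notMem _ (F.coeff n).2
      (hg P (Or.inl rfl) (fun _ _ => Iff.rfl) F (by rw [hF]; exact P.zero_mem) n)
  obtain ⟨w, hwr, A, B, hA, hB⟩ : ∃ w, (∀ s, w * s = 0 → s = 0) ∧ ∃ A B : R[X],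
      A.eval₂ R.subtype g = w * a ∧ B.eval₂ R.subtype g = w * b := by
    rw [hS] at ha hb
    obtain ⟨w₁, hw₁, hr₁, h₁⟩ := ha
    obtain ⟨w₂, hw₂, hr₂, h₂⟩ := hb
    obtain ⟨A, hA⟩ := mem_adjoinElement.1 (Subring.mul_mem _ hw₂ h₁)
    obtain ⟨B, hB⟩ := mem_adjoinElement.1 (Subring.mul_mem _ hw₁ h₂)
    exact ⟨w₁ * w₂, fun s hs => hr₂ s (hr₁ _ (by rwa [← mul_assoc])), A, B,
      hA.trans (by ring), hB.trans (by ring)⟩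
  have hA0 : A ≠ 0 := by
    rintro rfl
    rw [eval₂_zero] at hA
    exact ha0 (hwr a hA.symm)
  obtain ⟨F, G, V, W, r, hr0, hAB, hVW, hF0⟩ := Polynomial.exists_coprime_ratio hA0 B
  have hr0' : (r : T) ≠ 0 := fun h0 => hr0 (Subtype.ext h0)
  have hx0 : F.eval₂ R.subtype g ≠ 0 := fun h0 => hF0 (hg0 F h0)
  obtain ⟨n, hn⟩ := IsGoodSubring.exists_notMem_pow (T := T) hx0
  obtain ⟨δ, hδ, l', hl, hl'S, hl'⟩ := IsGoodSubring.exists_stripped (R := S)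
    (fun a ha ha0 t => hclosed ha ha0 t) n [F.eval₂ R.subtype g, G.eval₂ R.subtype g]
    (by simp [hgS]) ⟨_, by simp, hn⟩
  obtain ⟨x, z, rfl⟩ : ∃ x z, l' = [x, z] := by
    rw [← List.length_eq_two]
    simpa using (congrArg List.length hl).symm
  simp only [List.map_cons, List.map_nil, List.cons.injEq, and_true] at hl
  obtain ⟨hFx, hGz⟩ := hl
  have hδ0 : δ ≠ 0 := fun h0 => hx0 (by rw [hFx, h0, zero_mul])
  have hxne : x ≠ 0 := fun h0 => hx0 (by rw [hFx, h0, mul_zero])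
  have hxS : x ∈ S := hl'S x (by simp)
  have hzS : z ∈ S := hl'S z (by simp)
  have hABg := congrArg (fun H => eval₂ R.subtype g H) hAB
  have hVWg := congrArg (fun H => eval₂ R.subtype g H) hVW
  simp only [eval₂_mul, eval₂_add, eval₂_C, hA, hB, hFx, hGz, Subring.subtype_apply]
    at hABg hVWg
  have hazbx : a * z = b * x := sub_eq_zero.1
    (hreg hδ hδ0 _ (hwr _ (by linear_combination hABg)))
  have hxz : (Ideal.span {x}).IsRegularMod z := by
    refine Ideal.isRegularMod_of_forall_isAssPrime fun Q hQ hzQ => ?_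
    have hxQ : x ∈ Q := hQ.le (Ideal.mem_span_singleton_self x)
    have hrQ : (r : T) ∈ Q := by
      rw [← hVWg]
      exact Q.add_mem (Q.mul_mem_left _ (Q.mul_mem_left _ hxQ))
        (Q.mul_mem_left _ (Q.mul_mem_left _ hzQ))
    have hQr := hQ.of_mem (hreg hxS hxne) (hR.reg r r.2 hr0') hrQ
    have hQC := hQr.mem_controlledPrimes r.2 P
    obtain ⟨c, hc⟩ := hR.exists_isContractionGenerator r.2 hr0' hQr
    refine hl' c (h.le hc.1) (le_maximalIdeal hQ.1.ne_top
      (IsGoodSubring.IsContractionGenerator.mem hc)) ?_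
    simp [h.dvd_of_mem hR hQC hc hxS hxQ, h.dvd_of_mem hR hQC hc hzS hzQ]
  obtain ⟨e, he⟩ := Ideal.mem_span_singleton.1 (hxz a (by
    rw [mul_comm, hazbx]
    exact Ideal.mul_mem_left _ _ (Ideal.mem_span_singleton_self x)))
  refine ⟨e, hclosed hxS hxne e (he ▸ ha), x, hxS, z, hzS, by rw [he, mul_comm], ?_, hxz⟩
  refine sub_eq_zero.1 (hreg hxS hxne _ ?_)
  linear_combination z * he - hazbx

theorem isGoodSubring (hR : IsGoodSubring P R) (h : IsGenericExtension P R S) :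
    IsGoodSubring P S where
  reg _ ha ha0 := h.reg hR ha ha0
  notMem _ ha haP := h.eq_zero_of_mem (Or.inl rfl) hR.notMem ha haP
  closed _ ha ha0 := h.closed hR ha ha0
  gcd _ ha ha0 _ hb := h.exists_gcd hR ha ha0 hb

end IsGenericExtension

end GenericExtension

section Steps

open Cardinal Polynomial

section Combination

variable {T : Type*} [CommRing T]

/-- `c` is a linear combination of the entries of a list with coefficients in `S`. -/
def IsCombination (S : Subring T) : List T → T → Prop
  | [], c => c = 0
  | v :: ys, c => ∃ f ∈ S, IsCombination S ys (c - f * v)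

theorem IsCombination.mono {S S' : Subring T} (h : S ≤ S') {ys : List T} {c : T}
    (hc : IsCombination S ys c) : IsCombination S' ys c := by
  induction ys generalizing c with
  | nil => exact hc
  | cons v ys ih =>
    obtain ⟨f, hf, hc⟩ := hc
    exact ⟨f, h hf, ih hc⟩

theorem isCombination_zero (S : Subring T) (ys : List T) : IsCombination S ys 0 := by
  induction ys with
  | nil => rfl
  | cons v ys ih => exact ⟨0, S.zero_mem, by simpa using ih⟩

theorem IsCombination.map_mul {S : Subring T} {ys : List T} {c : T} (hc : IsCombination S ys c)
    (d : T) : IsCombination S (ys.map (d * ·)) (d * c) := by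
  induction ys generalizing c with
  | nil => rw [show c = 0 from hc, mul_zero]; rfl
  | cons v ys ih =>
    obtain ⟨f, hf, hc⟩ := hc
    refine ⟨f, hf, ?_⟩
    have : d * c - f * (d * v) = d * (c - f * v) := by ring
    rw [this]
    exact ih hc

theorem Ideal.mem_ofList_cons {v c : T} {ys : List T} (h : c ∈ Ideal.ofList (v :: ys)) :
    ∃ t, c - v * t ∈ Ideal.ofList ys := by
  rwa [Ideal.ofList_cons, sup_comm, Ideal.mem_sup_span] at h

theorem Ideal.mem_ofList_map_mul {d z : T} {ys : List T}
    (h : z ∈ Ideal.ofList (ys.map (d * ·))) : ∃ z' ∈ Ideal.ofList ys, z = d * z' := by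
  induction ys generalizing z with
  | nil => exact ⟨0, zero_mem _, by simpa using h⟩
  | cons v ys ih =>
    obtain ⟨t, ht⟩ := Ideal.mem_ofList_cons h
    obtain ⟨z', hz', he⟩ := ih ht
    refine ⟨v * t + z', ?_, by linear_combination he⟩
    rw [Ideal.ofList_cons]
    exact Submodule.add_mem_sup
      (Ideal.mul_mem_right _ _ (Ideal.mem_span_singleton_self v)) hz'

end Combination

theorem mk_fractionClosure_adjoinElement_le {T : Type u} [CommRing T] (R : Subring T) (g : T) :
    #(fractionClosure (adjoinElement R g)) ≤ max ℵ₀ #R := by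
  have h₁ : #(adjoinElement R g) ≤ max ℵ₀ #R :=
    (mk_le_of_surjective (RingHom.rangeRestrict_surjective (eval₂RingHom R.subtype g))).trans
      (cardinalMk_le_max.trans (max_comm _ _).le)
  have h₂ : #(fractionClosure (adjoinElement R g)) ≤ #(adjoinElement R g × adjoinElement R g) := by
    choose b hb hbr hbt using fun t : fractionClosure (adjoinElement R g) => t.2
    refine mk_le_of_injective (f := fun t => (⟨b t, hb t⟩, ⟨b t * t, hbt t⟩)) fun t s hts => ?_
    simp only [Prod.mk.injEq, Subtype.mk.injEq] at hts
    refine Subtype.ext (sub_eq_zero.1 (hbr t _ ?_))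
    rw [mul_sub, hts.2, hts.1, sub_self]
  refine h₂.trans ?_
  rw [mk_prod, lift_id]
  exact mul_le_of_le (le_max_left _ _) h₁ h₁

theorem fractionClosure_adjoinElement_le {T : Type u} [CommRing T] {R : Subring T} {d v c e f : T}
    (hd : d ∈ R) (hdr : ∀ t, d * t = 0 → t = 0) (hv : v ∈ R) (hc : c ∈ R)
    (h : d * e + v * f = c) :
    fractionClosure (adjoinElement R e) ≤ fractionClosure (adjoinElement R f) := by
  refine fractionClosure_le (adjoinElement_le
    ((le_adjoinElement R f).trans (le_fractionClosure _)) ⟨d, le_adjoinElement R f hd, hdr, ?_⟩)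
  rw [eq_sub_of_add_eq h]
  exact Subring.sub_mem _ (le_adjoinElement R f hc)
    (Subring.mul_mem _ (le_adjoinElement R f hv) (self_mem_adjoinElement R f))

/-- The maximal ideal is not associated to zero nor to any regular element. -/
def MaximalIdealNotAss (T : Type*) [CommRing T] [IsLocalRing T] : Prop :=
  ∀ r : T, (r = 0 ∨ ∀ t, r * t = 0 → t = 0) → ¬ (Ideal.span {r}).IsAssPrime (maximalIdeal T)

namespace IsGoodSubring

variable {T : Type u} [CommRing T] [IsLocalRing T] {P : Ideal T} {R : Subring T}

theorem ne_maximalIdeal (hR : IsGoodSubring P R) (hPM : P ≠ maximalIdeal T)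
    (hT : MaximalIdealNotAss T) {Q : Ideal T} (hQ : Q ∈ controlledPrimes P R) :
    Q ≠ maximalIdeal T := by
  rintro rfl
  rcases hQ with h | ⟨r, hr, hQ⟩
  · exact hPM h.symm
  · refine hT r ?_ hQ
    by_cases hr0 : r = 0
    exacts [Or.inl hr0, Or.inr (hR.reg r hr hr0)]

variable [IsNoetherianRing T] [IsAdicComplete (maximalIdeal T) T]

theorem exists_extension (hP : P.IsPrime) (hPM : P ≠ maximalIdeal T)
    (hT : MaximalIdealNotAss T) (hR : IsGoodSubring P R) (hcard : #R < #(ℕ → ResidueField T))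
    {d v c t₁ t₂ : T} (hd : d ∈ R) (hd0 : d ≠ 0) (hv : v ∈ R) (hv0 : v ≠ 0) (hc : c ∈ R)
    (hdv : ∀ Q ∈ controlledPrimes P R, d ∉ Q ∨ v ∉ Q) (ht : d * t₁ + v * t₂ = c)
    {J : Ideal T} (hJ : ∀ Q ∈ controlledPrimes P R, ¬ J ≤ Q) :
    ∃ S, R ≤ S ∧ IsGoodSubring P S ∧ #S ≤ max ℵ₀ #R ∧ ∃ s ∈ J, t₁ + s * v ∈ S ∧
      t₂ - s * d ∈ S := by
  obtain ⟨s, hs, hgen⟩ := exists_isGenericAt hP hcard (fun Q => hR.ne_maximalIdeal hPM hT) hJ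
    t₁ t₂ v d
  have hef : d * (t₁ + s * v) + v * (t₂ - s * d) = c := by linear_combination ht
  have hS : fractionClosure (adjoinElement R (t₁ + s * v))
      = fractionClosure (adjoinElement R (t₂ - s * d)) :=
    le_antisymm (fractionClosure_adjoinElement_le hd (hR.reg d hd hd0) hv hc hef)
      (fractionClosure_adjoinElement_le hv (hR.reg v hv hv0) hd hc ((add_comm _ _).trans hef))
  have hext : IsGenericExtension P R (fractionClosure (adjoinElement R (t₁ + s * v))) := by
    intro Q hQ
    by_cases hvQ : v ∈ Q
    · have hdQ : d ∉ Q := (hdv Q hQ).resolve_right (not_not_intro hvQ)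
      exact ⟨_, hS, fun Q' hQ' h => (hgen Q' hQ').2 (mt (h d hd).1 hdQ)⟩
    · exact ⟨_, rfl, fun Q' hQ' h => (hgen Q' hQ').1 (mt (h v hv).1 hvQ)⟩
  refine ⟨_, hext.le, hext.isGoodSubring hR, mk_fractionClosure_adjoinElement_le _ _, s, hs,
    le_fractionClosure _ (self_mem_adjoinElement _ _), ?_⟩
  rw [hS]
  exact le_fractionClosure _ (self_mem_adjoinElement _ _)

/-- A good subring can be enlarged so as to meet a given coset of the square of the maximal
ideal. -/
theorem exists_extension_meeting (hP : P.IsPrime) (hPM : P ≠ maximalIdeal T)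
    (hT : MaximalIdealNotAss T) (hR : IsGoodSubring P R) (hcard : #R < #(ℕ → ResidueField T))
    (u : T) : ∃ S, R ≤ S ∧ IsGoodSubring P S ∧ #S ≤ max ℵ₀ #R ∧
      ∃ a ∈ S, a - u ∈ maximalIdeal T ^ 2 := by
  obtain ⟨S, hRS, hS, hSc, s, hs, he, -⟩ := hR.exists_extension hP hPM hT hcard (d := 1) (v := 1)
    (c := 0) (t₁ := u) (t₂ := -u) R.one_mem one_ne_zero R.one_mem one_ne_zero R.zero_mem
    (fun Q hQ => Or.inl fun h1 =>
      (isPrime_of_mem hP hQ).ne_top ((Ideal.eq_top_iff_one Q).2 h1)) (by ring)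
    (J := maximalIdeal T ^ 2) (fun Q hQ hle => by
      have hQp := isPrime_of_mem hP hQ
      exact hR.ne_maximalIdeal hPM hT hQ
        (le_antisymm (le_maximalIdeal hQp.ne_top) (hQp.le_of_pow_le hle)))
  exact ⟨S, hRS, hS, hSc, _, he, by simpa using hs⟩

/-- A good subring can be enlarged so that a given relation over `T` is realized over the
subring. -/
theorem exists_extension_isCombination (hP : P.IsPrime) (hPM : P ≠ maximalIdeal T)
    (hT : MaximalIdealNotAss T) (n : ℕ) : ∀ (R : Subring T), IsGoodSubring P R →
      #R < #(ℕ → ResidueField T) → ∀ (ys : List T), ys.length = n → (∀ y ∈ ys, y ∈ R) →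
      ∀ c ∈ R, c ∈ Ideal.ofList ys →
      ∃ S, R ≤ S ∧ IsGoodSubring P S ∧ #S ≤ max ℵ₀ #R ∧ IsCombination S ys c := by
  induction n with
  | zero =>
    intro R hR _ ys hys _ c _ hc
    rw [List.length_eq_zero_iff.1 hys] at hc ⊢
    exact ⟨R, le_rfl, hR, le_max_right _ _, by simpa [IsCombination] using hc⟩
  | succ n ih =>
    intro R hR hcard ys hlen hys c hcR hc
    obtain ⟨v, ys, rfl⟩ := List.exists_cons_of_length_eq_add_one hlen
    have hlen' : ys.length = n := by simpa using hlen
    have hv : v ∈ R := hys v (by simp)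
    have hysR : ∀ y ∈ ys, y ∈ R := fun y hy => hys y (by simp [hy])
    obtain ⟨t₂, ht₂⟩ := Ideal.mem_ofList_cons hc
    by_cases hv0 : v = 0
    · obtain ⟨S, hRS, hS, hSc, h⟩ := ih R hR hcard ys hlen' hysR c hcR
        (by simpa [hv0] using ht₂)
      exact ⟨S, hRS, hS, hSc, 0, S.zero_mem, by simpa using h⟩
    by_cases hys0 : ∀ y ∈ ys, y = 0
    · have h0 : Ideal.ofList ys = ⊥ := by
        rw [Ideal.ofList, Ideal.span_eq_bot]
        exact hys0
      rw [h0, Ideal.mem_bot, sub_eq_zero] at ht₂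
      refine ⟨R, le_rfl, hR, le_max_right _ _, t₂, hR.closed v hv hv0 t₂ (ht₂ ▸ hcR), ?_⟩
      rw [ht₂, mul_comm, sub_self]
      exact isCombination_zero R ys
    push Not at hys0
    obtain ⟨y, hy, hy0⟩ := hys0
    obtain ⟨k, hk⟩ := exists_notMem_pow hy0
    obtain ⟨d, hd, ys', rfl, hys', hstrip⟩ := exists_stripped hR.closed k ys hysR ⟨y, hy, hk⟩
    obtain ⟨y', hy', rfl⟩ := List.mem_map.1 hy
    obtain ⟨t₁, ht₁, hct⟩ := Ideal.mem_ofList_map_mul ht₂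
    obtain ⟨δ, hδ, d₁, hd₁, v₁, hv₁, rfl, rfl, hdv⟩ :=
      hR.gcd d hd (left_ne_zero_of_mul hy0) v hv
    have hd0 : δ * d₁ ≠ 0 := left_ne_zero_of_mul hy0
    obtain ⟨S₁, hRS₁, hS₁, hSc₁, s, hs, he, hf⟩ := hR.exists_extension hP hPM hT hcard
      (t₁ := t₁) (t₂ := t₂) hd₁ (right_ne_zero_of_mul hd0) hv₁ (right_ne_zero_of_mul hv0)
      (hR.closed δ hδ (left_ne_zero_of_mul hd0) (d₁ * t₁ + v₁ * t₂) (by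
        convert! hcR using 1
        linear_combination -hct))
      (fun Q => hR.notMem_or_notMem hd₁ (right_ne_zero_of_mul hd0) hdv) rfl
      (J := Ideal.ofList ys') (fun Q hQ hle => by
        have hmem : ∀ z ∈ ys', z ∈ Q := fun z hz => hle (Ideal.subset_span hz)
        rcases hR.controlled_cases hQ with h0 | ⟨h, hh⟩
        · exact right_ne_zero_of_mul hy0 (h0 y' (hys' y' hy') (hmem y' hy'))
        · exact hstrip h hh.1 (le_maximalIdeal hh.2.2.1.ne_top (IsContractionGenerator.mem hh))
            fun z hz => (hh.2.2.2 z (hys' z hz)).1 (hmem z hz))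
    have hcard₁ : #S₁ < #(ℕ → ResidueField T) :=
      hSc₁.trans_lt (max_lt (aleph0_lt_mk_residue_seq T) hcard)
    obtain ⟨S, hS₁S, hS, hSc, hcomb⟩ := ih S₁ hS₁ hcard₁ ys' (by simpa using hlen')
      (fun z hz => hRS₁ (hys' z hz)) _ he
      (Ideal.add_mem _ ht₁ (Ideal.mul_mem_right _ _ hs))
    refine ⟨S, hRS₁.trans hS₁S, hS, hSc.trans (max_le (le_max_left _ _) hSc₁), _, hS₁S hf, ?_⟩
    convert! hcomb.map_mul (δ * d₁) using 1
    linear_combination hct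

end IsGoodSubring

end Steps

section Closure

open Cardinal

/-- Every task can be scheduled cofinally often along an initial ordinal. -/
theorem exists_cofinal_schedule {κ : Cardinal.{u}} (hκ : ℵ₀ < κ) {Task : Type u} [Nonempty Task]
    (hTask : #Task ≤ κ) :
    ∃ τ : κ.ord.ToType → Task, ∀ j t, ∃ i, j < i ∧ τ i = t := by
  have hcard : #(κ.ord.ToType × Task) ≤ #κ.ord.ToType := by
    rw [mk_prod, lift_id, lift_id, mk_ord_toType]
    exact mul_le_of_le hκ.le le_rfl hTask
  have hne : Nonempty κ.ord.ToType := by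
    rw [← mk_ne_zero_iff, mk_ord_toType]
    exact (aleph0_pos.trans hκ).ne'
  obtain ⟨g⟩ := (Cardinal.le_def _ _).1 hcard
  obtain ⟨f, hf⟩ : ∃ f : κ.ord.ToType → κ.ord.ToType × Task, Function.Surjective f :=
    ⟨_, Function.invFun_surjective g.injective⟩
  refine ⟨fun i => (f i).2, fun j t => ?_⟩
  by_contra! hc
  have hle : #κ.ord.ToType ≤ #(Set.Iic j) := by
    refine mk_le_of_surjective (f := fun i => (f i.1).1) fun x => ?_
    obtain ⟨i, hi⟩ := hf (x, t)
    refine ⟨⟨i, not_lt.1 fun hji => hc i hji (by rw [hi])⟩, by simp [hi]⟩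
  rw [mk_ord_toType, ← Set.Iio_insert] at hle
  refine (hle.trans mk_insert_le).not_gt ?_
  exact add_lt_of_lt hκ.le (by simpa using mk_Iio_lt j) (one_lt_aleph0.trans hκ)

variable {T : Type u} [CommRing T]

theorem mk_iSup_le_of_directed {ι : Type u} {S : ι → Subring T} (hS : Directed (· ≤ ·) S)
    {κ : Cardinal.{u}} (hκ : ℵ₀ ≤ κ) (hι : #ι ≤ κ) (h : ∀ i, #(S i) ≤ κ) :
    #(⨆ i, S i : Subring T) ≤ κ := by
  cases isEmpty_or_nonempty ι
  · rw [iSup_of_empty]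
    refine le_trans ?_ hκ
    rw [mk_le_aleph0_iff, ← SetLike.coe_sort_coe, Set.countable_coe_iff, Subring.coe_bot]
    exact Set.countable_range _
  · rw [← SetLike.coe_sort_coe, Subring.coe_iSup_of_directed hS]
    exact (mk_iUnion_le _).trans (mul_le_of_le hκ hι (ciSup_le' h))

/-- Transfinite construction of a subring closed under a family of one-step enlargements. -/
theorem exists_closed_subring {κ : Cardinal.{u}} (hκ : ℵ₀ < κ) {Task : Type u} [Nonempty Task]
    (hTask : #Task ≤ κ) (Good : Subring T → Prop)
    (hsup : ∀ (ι : Type u) (S : ι → Subring T), Directed (· ≤ ·) S → (∀ i, Good (S i)) →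
      Good (⨆ i, S i))
    (Sat : Task → Subring T → Subring T → Prop)
    (hstep : ∀ t R, Good R → #R < κ → ∃ S, R ≤ S ∧ Good S ∧ #S ≤ max ℵ₀ #R ∧ Sat t R S) :
    ∃ A, Good A ∧ ∀ t, ∀ l : List T, (∀ y ∈ l, y ∈ A) → ∃ R S, (∀ y ∈ l, y ∈ R) ∧ S ≤ A ∧
      Sat t R S := by
  classical
  obtain ⟨τ, hτ⟩ := exists_cofinal_schedule hκ hTask
  choose! next hle hgood hcard hsat using hstep
  let step (t : Task) (R : Subring T) : Subring T := if Good R ∧ #R < κ then next t R else R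
  let S : κ.ord.ToType → Subring T := WellFounded.fix (r := (· < ·)) wellFounded_lt
    fun i S => step (τ i) (⨆ j : Set.Iio i, S j j.2)
  let B (i : κ.ord.ToType) : Subring T := ⨆ j : Set.Iio i, S j
  have hS (i) : S i = step (τ i) (B i) := WellFounded.fix_eq _ _ _
  have hstep_le (t R) : R ≤ step t R := by
    by_cases h : Good R ∧ #R < κ
    · simpa only [step, if_pos h] using hle t R h.1 h.2
    · simp only [step, if_neg h, le_refl]
  have hmono : Monotone S := monotone_iff_forall_lt.2 fun j i hji =>
    (le_iSup (fun j : Set.Iio i => S j) ⟨j, hji⟩).trans ((hstep_le (τ i) (B i)).trans (hS i).ge)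
  have hdir (i : κ.ord.ToType) : Directed (· ≤ ·) fun j : Set.Iio i => S j :=
    Monotone.directed_le fun _ _ h => hmono h
  have hκi (i : κ.ord.ToType) : max ℵ₀ #(Set.Iio i) < κ := max_lt hκ (by simpa using mk_Iio_lt i)
  have hB (i : κ.ord.ToType) (h : ∀ j < i, Good (S j) ∧ #(S j) ≤ max ℵ₀ #(Set.Iio j)) :
      Good (B i) ∧ #(B i) ≤ max ℵ₀ #(Set.Iio i) :=
    ⟨hsup _ _ (hdir i) fun j => (h j j.2).1, mk_iSup_le_of_directed (hdir i) (le_max_left _ _)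
      (le_max_right _ _) fun j => (h j j.2).2.trans
        (max_le_max le_rfl (mk_le_mk_of_subset (Set.Iio_subset_Iio (le_of_lt j.2))))⟩
  have hall (i : κ.ord.ToType) : Good (S i) ∧ #(S i) ≤ max ℵ₀ #(Set.Iio i) := by
    induction i using WellFoundedLT.induction with
    | ind i ih =>
      obtain ⟨hg, hc⟩ := hB i ih
      have hlt := hc.trans_lt (hκi i)
      rw [hS i, show step (τ i) (B i) = next (τ i) (B i) from if_pos ⟨hg, hlt⟩]
      exact ⟨hgood _ _ hg hlt, (hcard _ _ hg hlt).trans (max_le (le_max_left _ _) hc)⟩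
  have hne : Nonempty κ.ord.ToType := by
    rw [← mk_ne_zero_iff, mk_ord_toType]
    exact (aleph0_pos.trans hκ).ne'
  refine ⟨⨆ i, S i, hsup _ _ hmono.directed_le fun i => (hall i).1, fun t l hl => ?_⟩
  obtain ⟨j, hj⟩ : ∃ j, ∀ y ∈ l, y ∈ S j := by
    induction l with
    | nil => exact ⟨Classical.arbitrary _, by simp⟩
    | cons v l ih =>
      obtain ⟨j, hj⟩ := ih fun y hy => hl y (by simp [hy])
      obtain ⟨k, hk⟩ := (Subring.mem_iSup_of_directed hmono.directed_le).1 (hl v (by simp))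
      refine ⟨max j k, fun y hy => ?_⟩
      rcases List.mem_cons.1 hy with rfl | hy
      exacts [hmono (le_max_right _ _) hk, hmono (le_max_left _ _) (hj y hy)]
  obtain ⟨i, hji, rfl⟩ := hτ j t
  obtain ⟨hg, hc⟩ := hB i fun j _ => hall j
  refine ⟨B i, S i, fun y hy => le_iSup (fun j : Set.Iio i => S j) ⟨j, hji⟩ (hj y hy),
    le_iSup S i, ?_⟩
  have hlt := hc.trans_lt (hκi i)
  rw [hS i, show step (τ i) (B i) = next (τ i) (B i) from if_pos ⟨hg, hlt⟩]
  exact hsat _ _ hg hlt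

theorem isGoodSubring_of_forall_exists_mul_eq_one {P : Ideal T} (hP : P ≠ ⊤) {R : Subring T}
    (h : ∀ a ∈ R, a ≠ 0 → ∃ b ∈ R, a * b = 1) : IsGoodSubring P R where
  reg a ha ha0 t hat := by
    obtain ⟨b, -, hab⟩ := h a ha ha0
    linear_combination b * hat - t * hab
  notMem a ha haP := by
    by_contra ha0
    obtain ⟨b, -, hab⟩ := h a ha ha0
    exact hP ((Ideal.eq_top_iff_one P).2 (hab ▸ P.mul_mem_right b haP))
  closed a ha ha0 t hat := by
    obtain ⟨b, hb, hab⟩ := h a ha ha0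
    have : t = b * (a * t) := by linear_combination (-t) * hab
    rw [this]
    exact R.mul_mem hb hat
  gcd a ha ha0 c hc := by
    obtain ⟨b, hb, hab⟩ := h a ha ha0
    refine ⟨a, ha, 1, R.one_mem, b * c, R.mul_mem hb hc, (mul_one a).symm,
      by linear_combination (-c) * hab, fun t _ => ?_⟩
    simp

theorem isGoodSubring_bot {P : Ideal T} (hP : P ≠ ⊤) (p : ℕ) [Fact p.Prime] [CharP T p] :
    IsGoodSubring P (⊥ : Subring T) := by
  refine isGoodSubring_of_forall_exists_mul_eq_one hP fun a ha ha0 => ?_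
  obtain ⟨n, rfl⟩ := Subring.mem_bot.1 ha
  have hn : (n : ZMod p) ≠ 0 := fun h => ha0 (by
    simpa using congrArg (ZMod.castHom (dvd_refl p) T) h)
  obtain ⟨m, hm⟩ := ZMod.intCast_surjective ((n : ZMod p)⁻¹)
  refine ⟨m, Subring.mem_bot.2 ⟨m, rfl⟩, ?_⟩
  have := congrArg (ZMod.castHom (dvd_refl p) T) (mul_inv_cancel₀ hn)
  rw [← hm] at this
  simpa using this

theorem IsGoodSubring.iSup {P : Ideal T} {ι : Type*} [Nonempty ι] {S : ι → Subring T}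
    (hS : Directed (· ≤ ·) S) (h : ∀ i, IsGoodSubring P (S i)) :
    IsGoodSubring P (⨆ i, S i) where
  reg a ha ha0 := by
    obtain ⟨i, hi⟩ := (Subring.mem_iSup_of_directed hS).1 ha
    exact (h i).reg a hi ha0
  notMem a ha := by
    obtain ⟨i, hi⟩ := (Subring.mem_iSup_of_directed hS).1 ha
    exact (h i).notMem a hi
  closed a ha ha0 t hat := by
    obtain ⟨i, hi⟩ := (Subring.mem_iSup_of_directed hS).1 ha
    obtain ⟨j, hj⟩ := (Subring.mem_iSup_of_directed hS).1 hat
    obtain ⟨k, hik, hjk⟩ := hS i j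
    exact le_iSup S k ((h k).closed a (hik hi) ha0 t (hjk hj))
  gcd a ha ha0 b hb := by
    obtain ⟨i, hi⟩ := (Subring.mem_iSup_of_directed hS).1 ha
    obtain ⟨j, hj⟩ := (Subring.mem_iSup_of_directed hS).1 hb
    obtain ⟨k, hik, hjk⟩ := hS i j
    obtain ⟨e, he, a', ha', b', hb', h'⟩ := (h k).gcd a (hik hi) ha0 b (hjk hj)
    exact ⟨e, le_iSup S k he, a', le_iSup S k ha', b', le_iSup S k hb', h'⟩

variable [IsLocalRing T] [IsNoetherianRing T] [IsAdicComplete (maximalIdeal T) T]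

/-- A good subring that is dense modulo the square of the maximal ideal and from which every ideal
extended to `T` contracts back. -/
theorem exists_isGoodSubring_dense {P : Ideal T} (hP : P.IsPrime) (hPM : P ≠ maximalIdeal T)
    (hT : MaximalIdealNotAss T) (p : ℕ) [Fact p.Prime] [CharP T p] :
    ∃ A : Subring T, IsGoodSubring P A ∧ (∀ u, ∃ a ∈ A, a - u ∈ maximalIdeal T ^ 2) ∧
      ∀ ys : List T, (∀ y ∈ ys, y ∈ A) → ∀ c ∈ A, c ∈ Ideal.ofList ys → IsCombination A ys c := by
  have hκ := aleph0_lt_mk_residue_seq T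
  have hTκ := mk_le_mk_residue_seq T
  obtain ⟨A, hA, hsat⟩ := exists_closed_subring hκ (Task := T × (T × List T)) (by
      rw [mk_prod, mk_prod]
      simp only [lift_id]
      refine mul_le_of_le hκ.le hTκ (mul_le_of_le hκ.le hTκ ?_)
      exact (mk_list_le_max T).trans (max_le hκ.le hTκ))
    (IsGoodSubring P)
    (fun ι S hS h => by
      cases isEmpty_or_nonempty ι
      · rw [iSup_of_empty]
        exact isGoodSubring_bot hP.ne_top p
      · exact IsGoodSubring.iSup hS h)
    (fun t R S => (∃ a ∈ S, a - t.1 ∈ maximalIdeal T ^ 2) ∧ (t.2.1 ∈ R → (∀ y ∈ t.2.2, y ∈ R) →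
      t.2.1 ∈ Ideal.ofList t.2.2 → IsCombination S t.2.2 t.2.1))
    (fun t R hR hcard => by
      obtain ⟨S, hRS, hS, hSc, hu⟩ := hR.exists_extension_meeting hP hPM hT hcard t.1
      by_cases ht : t.2.1 ∈ R ∧ (∀ y ∈ t.2.2, y ∈ R) ∧ t.2.1 ∈ Ideal.ofList t.2.2
      · obtain ⟨S', hSS', hS', hSc', hcomb⟩ :=
          IsGoodSubring.exists_extension_isCombination hP hPM hT _ S hS
            (hSc.trans_lt (max_lt hκ hcard)) t.2.2 rfl (fun y hy => hRS (ht.2.1 y hy)) t.2.1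
            (hRS ht.1) ht.2.2
        obtain ⟨a, ha, hau⟩ := hu
        exact ⟨S', hRS.trans hSS', hS', hSc'.trans (max_le (le_max_left _ _) hSc),
          ⟨a, hSS' ha, hau⟩, fun _ _ _ => hcomb⟩
      · exact ⟨S, hRS, hS, hSc, hu, fun h₁ h₂ h₃ => (ht ⟨h₁, h₂, h₃⟩).elim⟩)
  refine ⟨A, hA, fun u => ?_, fun ys hys c hc hcy => ?_⟩
  · obtain ⟨R, S, -, hSA, ⟨a, ha, hau⟩, -⟩ := hsat (u, 0, []) [] (by simp)
    exact ⟨a, hSA ha, hau⟩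
  · obtain ⟨R, S, hR, hSA, -, h⟩ := hsat (0, c, ys) (c :: ys) (by simpa using ⟨hc, hys⟩)
    exact (h (hR c (by simp)) (fun y hy => hR y (by simp [hy])) hcy).mono hSA

end Closure

section Completion

variable {A T : Type*} [CommRing A] [CommRing T] {M : Ideal T} {m : Ideal A}

/-- A dense ring homomorphism along which powers of an ideal contract correctly identifies the
completion of the source with the target. -/
theorem nonempty_adicCompletion_equiv [IsAdicComplete M T] (f : A →+* T)
    (hcomap : ∀ n, Ideal.comap f (M ^ n) = m ^ n) (hdense : ∀ n t, ∃ a, f a - t ∈ M ^ n) :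
    Nonempty (AdicCompletion m A ≃+* T) := by
  let g (n : ℕ) : AdicCompletion m A →+* T ⧸ M ^ n :=
    (Ideal.quotientMap (M ^ n) f (hcomap n).ge).comp (AdicCompletion.evalₐ m n : _ →+* _)
  have hg (n : ℕ) (a : AdicCompletion.AdicCauchySequence m A) :
      g n (AdicCompletion.mk m A a) = Ideal.Quotient.mk (M ^ n) (f (a n)) := by
    simp only [g, RingHom.comp_apply, RingHom.coe_coe, AdicCompletion.evalₐ_mk,
      Ideal.quotientMap_mk]
  have hcompat {k n : ℕ} (hkn : k ≤ n) : (Ideal.Quotient.factorPow M hkn).comp (g n) = g k := by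
    ext x
    obtain ⟨a, rfl⟩ := AdicCompletion.mk_surjective m A x
    rw [RingHom.comp_apply, hg, hg]
    change Ideal.Quotient.mk (M ^ k) (f (a n)) = _
    rw [Ideal.Quotient.eq, ← map_sub, ← Ideal.mem_comap, hcomap, ← Ideal.Quotient.eq]
    exact AdicCompletion.Ideal.mk_eq_mk m hkn a
  let φ := IsAdicComplete.liftRingHom M g hcompat
  have hφ (n : ℕ) (x) : Ideal.Quotient.mk (M ^ n) (φ x) = g n x :=
    IsAdicComplete.mk_liftRingHom M g hcompat n x
  refine ⟨RingEquiv.ofBijective φ ⟨(injective_iff_map_eq_zero φ).2 fun x hx => ?_, fun t => ?_⟩⟩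
  · refine AdicCompletion.ext_evalₐ fun n => ?_
    apply Ideal.quotientMap_injective' (H := (hcomap n).ge) (hcomap n).le
    rw [map_zero, map_zero]
    exact (hφ n x).symm.trans (by rw [hx, map_zero])
  · choose a ha using fun n => hdense n t
    refine ⟨AdicCompletion.mk m A (AdicCompletion.AdicCauchySequence.mk m A a fun n => ?_), ?_⟩
    · rw [SModEq.sub_mem, smul_eq_mul, Ideal.mul_top, ← hcomap, Ideal.mem_comap, map_sub]
      have := sub_mem (ha n) (Ideal.pow_le_pow_right n.le_succ (ha (n + 1)))
      simpa using this
    · refine IsHausdorff.eq_iff_smodEq (I := M) |>.2 fun n => ?_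
      rw [SModEq.sub_mem, smul_eq_mul, Ideal.mul_top, ← Ideal.Quotient.eq, hφ, hg,
        Ideal.Quotient.eq]
      exact ha n

end Completion

section Precompletion

variable {T : Type*} [CommRing T]

theorem IsCombination.mem_of_forall_mem {A : Subring T} {J : Ideal A} {ys : List T} {c : T}
    (h : IsCombination A ys c) (hys : ∀ y ∈ ys, ∃ a ∈ J, (a : T) = y) :
    ∃ a ∈ J, (a : T) = c := by
  induction ys generalizing c with
  | nil => exact ⟨0, J.zero_mem, (show c = 0 from h).symm⟩
  | cons v ys ih =>
    obtain ⟨f, hf, h⟩ := h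
    obtain ⟨a, ha, hac⟩ := ih h fun y hy => hys y (by simp [hy])
    obtain ⟨b, hb, rfl⟩ := hys v (by simp)
    exact ⟨a + ⟨f, hf⟩ * b, J.add_mem ha (J.mul_mem_left _ hb), by
      rw [Subring.coe_add, Subring.coe_mul, hac]; ring⟩

theorem comap_map_subtype_of_isCombination {A : Subring T}
    (h : ∀ ys : List T, (∀ y ∈ ys, y ∈ A) → ∀ c ∈ A, c ∈ Ideal.ofList ys → IsCombination A ys c)
    (J : Ideal A) : (J.map A.subtype).comap A.subtype = J := by
  refine le_antisymm (fun c hc => ?_) Ideal.le_comap_map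
  obtain ⟨s, hs, hcs⟩ := Submodule.mem_span_finite_of_mem_span (Ideal.mem_comap.1 hc)
  have hsJ : ∀ y ∈ s.toList, ∃ a ∈ J, (a : T) = y := fun y hy => hs (Finset.mem_toList.1 hy)
  have hmem : (c : T) ∈ Ideal.ofList s.toList := by
    simpa [Ideal.ofList, Ideal.span] using hcs
  obtain ⟨a, ha, hac⟩ := (h s.toList (fun y hy => by
    obtain ⟨a, -, rfl⟩ := hsJ y hy
    exact a.2) c c.2 hmem).mem_of_forall_mem hsJ
  exact Subtype.ext hac ▸ ha

theorem isNoetherianRing_of_comap_map {A : Type*} [CommRing A] [IsNoetherianRing T] (f : A →+* T)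
    (h : ∀ J : Ideal A, (J.map f).comap f = J) : IsNoetherianRing A := by
  have hmono : StrictMono (Ideal.map f) := Monotone.strictMono_of_injective
    (fun _ _ hIJ => Ideal.map_mono hIJ) fun I J hIJ => by rw [← h I, hIJ, h J]
  have : WellFoundedGT (Ideal T) := isNoetherian_iff'.1 (inferInstanceAs (IsNoetherian T T))
  exact isNoetherian_iff'.2 hmono.wellFoundedGT

theorem map_comap_maximalIdeal [IsLocalRing T] [IsNoetherianRing T] {A : Subring T}
    (h : ∀ u, ∃ a ∈ A, a - u ∈ maximalIdeal T ^ 2) :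
    ((maximalIdeal T).comap A.subtype).map A.subtype = maximalIdeal T := by
  refine le_antisymm Ideal.map_comap_le (Submodule.le_of_le_smul_of_le_jacobson_bot
    (I := maximalIdeal T) (IsNoetherian.noetherian _) (maximalIdeal_le_jacobson _) fun u hu => ?_)
  obtain ⟨a, ha, hau⟩ := h u
  have haM : a ∈ maximalIdeal T := by
    have := Ideal.add_mem _ (Ideal.pow_le_self two_ne_zero hau) hu
    rwa [sub_add_cancel] at this
  have : u = a + -(a - u) := by ring
  rw [this, smul_eq_mul, ← pow_two]
  exact Submodule.add_mem_sup (Ideal.mem_map_of_mem A.subtype (x := ⟨a, ha⟩) haM)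
    (neg_mem hau)

theorem exists_sub_mem_pow [IsLocalRing T] {A : Subring T}
    (h : ∀ u, ∃ a ∈ A, a - u ∈ maximalIdeal T)
    (hM : ((maximalIdeal T).comap A.subtype).map A.subtype = maximalIdeal T) (n : ℕ) (u : T) :
    ∃ a : A, A.subtype a - u ∈ maximalIdeal T ^ n := by
  have key (n : ℕ) (x : T) (hx : x ∈ maximalIdeal T ^ n) :
      ∃ a : A, A.subtype a - x ∈ maximalIdeal T ^ (n + 1) := by
    nth_rw 1 [← hM] at hx
    rw [← Ideal.map_pow] at hx
    suffices H : ∀ t, ∃ a : A, A.subtype a - t * x ∈ maximalIdeal T ^ (n + 1) by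
      simpa using H 1
    refine Submodule.span_induction (p := fun x _ =>
      ∀ t, ∃ a : A, A.subtype a - t * x ∈ maximalIdeal T ^ (n + 1)) ?_ ?_ ?_ ?_ hx
    · rintro _ ⟨b, hb, rfl⟩ t
      obtain ⟨a, ha, hat⟩ := h t
      have hb' : A.subtype b ∈ maximalIdeal T ^ n := by
        rw [← hM, ← Ideal.map_pow]
        exact Ideal.mem_map_of_mem _ hb
      refine ⟨⟨a, ha⟩ * b, ?_⟩
      rw [map_mul, ← sub_mul, pow_succ']
      exact Ideal.mul_mem_mul hat hb'
    · exact fun t => ⟨0, by simp⟩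
    · intro x z _ _ hx hz t
      obtain ⟨a, ha⟩ := hx t
      obtain ⟨b, hb⟩ := hz t
      refine ⟨a + b, ?_⟩
      have := add_mem ha hb
      rwa [show A.subtype a - t * x + (A.subtype b - t * z) = A.subtype (a + b) - t * (x + z) by
        rw [map_add]; ring] at this
    · intro r x _ hx t
      simpa only [smul_eq_mul, mul_assoc] using hx (t * r)
  induction n generalizing u with
  | zero => exact ⟨0, by simp⟩
  | succ n ih =>
    obtain ⟨a, ha⟩ := ih u
    obtain ⟨b, hb⟩ := key n _ ha
    refine ⟨a - b, ?_⟩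
    have : A.subtype (a - b) - u = -(A.subtype b - (A.subtype a - u)) := by
      rw [map_sub]; ring
    rw [this]
    exact neg_mem hb

end Precompletion

/-- A Noetherian domain in which any two elements have a greatest common divisor after division by
which the first is coprime to the second is factorial. -/
theorem uniqueFactorizationMonoid_of_exists_gcd {A : Type*} [CommRing A] [IsDomain A]
    [IsNoetherianRing A]
    (h : ∀ a b : A, a ≠ 0 → ∃ d a' b' : A, a = d * a' ∧ b = d * b' ∧
      ∀ c, a' ∣ b' * c → a' ∣ c) : UniqueFactorizationMonoid A where
  irreducible_iff_prime {q} := by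
    refine ⟨fun hq => ⟨hq.ne_zero, hq.not_isUnit, fun a b hab => ?_⟩, Prime.irreducible⟩
    obtain ⟨d, q', a', hqd, rfl, hreg⟩ := h q a hq.ne_zero
    have hd : d ≠ 0 := fun hd => hq.ne_zero (by rw [hqd, hd, zero_mul])
    rcases hq.isUnit_or_isUnit hqd with hu | hu
    · right
      have hq' : q ∣ q' := by
        obtain ⟨v, rfl⟩ := hu
        exact ⟨↑v⁻¹, by rw [hqd, mul_right_comm, Units.mul_inv, one_mul]⟩
      refine (show q ∣ q' from hq').trans (hreg b ?_)
      rwa [hqd, mul_assoc, mul_dvd_mul_iff_left hd] at hab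
    · left
      obtain ⟨v, rfl⟩ := hu
      exact ⟨↑v⁻¹ * a', by rw [hqd]; simp [mul_assoc]⟩

namespace IsGoodSubring

variable {T : Type*} [CommRing T] {P : Ideal T} {A : Subring T}

theorem isDomain [Nontrivial T] (hA : IsGoodSubring P A) : IsDomain A := by
  have : NoZeroDivisors A := ⟨fun {a b} hab => by
    by_contra! hne
    exact hne.2 (Subtype.ext (hA.reg a a.2 (fun h => hne.1 (Subtype.ext h)) b
      (congrArg Subtype.val hab)))⟩
  exact NoZeroDivisors.to_isDomain A

theorem dvd_of_coe_dvd (hA : IsGoodSubring P A) {a b : A} (ha : a ≠ 0) (h : (a : T) ∣ b) :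
    a ∣ b := by
  obtain ⟨t, ht⟩ := h
  exact ⟨⟨t, hA.closed a a.2 (fun h => ha (Subtype.ext h)) t (ht ▸ b.2)⟩, Subtype.ext ht⟩

theorem isLocalHom_subtype [Nontrivial T] (hA : IsGoodSubring P A) : IsLocalHom A.subtype where
  map_nonunit a ha := by
    refine isUnit_of_dvd_one (hA.dvd_of_coe_dvd ?_ ha.dvd)
    rintro rfl
    simp at ha

theorem uniqueFactorizationMonoid [Nontrivial T] (hA : IsGoodSubring P A) [IsDomain A]
    [IsNoetherianRing A] :
    UniqueFactorizationMonoid A := by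
  refine uniqueFactorizationMonoid_of_exists_gcd fun a b ha => ?_
  obtain ⟨h, hh, a', ha', b', hb', hab, hbb, hreg⟩ :=
    hA.gcd a a.2 (fun h => ha (Subtype.ext h)) b b.2
  refine ⟨⟨h, hh⟩, ⟨a', ha'⟩, ⟨b', hb'⟩, Subtype.ext hab, Subtype.ext hbb, fun c hc => ?_⟩
  refine hA.dvd_of_coe_dvd ?_ ?_
  · rintro h0
    refine ha (Subtype.ext ?_)
    rw [hab, show a' = 0 from congrArg Subtype.val h0]
    simp
  · refine Ideal.mem_span_singleton.1 (hreg c ?_)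
    obtain ⟨t, ht⟩ := hc
    exact Ideal.mem_span_singleton.2 ⟨t, congrArg Subtype.val ht⟩

end IsGoodSubring

theorem Ideal.map_frobPow {A T : Type*} [CommRing A] [CommRing T] {p : ℕ} [ExpChar A p]
    [ExpChar T p] (f : A →+* T) (I : Ideal A) (e : ℕ) :
    (I.frobPow (p ^ e)).map f = (I.map f).frobPow (p ^ e) := by
  rw [frobPow_eq_map, frobPow_eq_map, Ideal.map_map, Ideal.map_map]
  congr 1
  ext x
  simp [iterateFrobenius_def]

/-- A domain is F-regular as soon as membership in ideals can be tested, for every nonzero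
multiplier, on arbitrarily large Frobenius powers. -/
theorem FRegular.of_forall {A : Type*} [CommRing A] [IsDomain A] {p : ℕ} [Fact p.Prime] [CharP A p]
    (h : ∀ c : A, c ≠ 0 → ∀ E, ∃ e, E ≤ e ∧ ∀ (J : Ideal A) (u : A),
      c * u ^ p ^ e ∈ J.frobPow (p ^ e) → u ∈ J) : FRegular A p := by
  intro S J x ⟨c, hc, E, hE⟩
  by_cases h0 : (0 : A) ∈ S
  · have := IsLocalization.subsingleton (M := S) (S := Localization S) h0
    rw [Subsingleton.elim x 0]
    exact J.zero_mem
  have hS : S ≤ nonZeroDivisors A := le_nonZeroDivisors_of_noZeroDivisors h0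
  have hdom := IsLocalization.isDomain_localization hS
  have hinj := IsLocalization.injective (Localization S) hS
  have := charP_of_injective_algebraMap hinj p
  have hc0 : c ≠ 0 := fun h => hc ⊥ (by simp [IsDomain.minimalPrimes_eq_singleton_bot]) h
  obtain ⟨⟨c', s⟩, hcs⟩ := IsLocalization.surj S c
  obtain ⟨⟨u, t⟩, hut⟩ := IsLocalization.surj S x
  dsimp only at hcs hut
  have hs := IsLocalization.map_units (Localization S) s
  have ht := IsLocalization.map_units (Localization S) t
  have hc' : c' ≠ 0 := by
    rintro rfl
    rw [map_zero, mul_eq_zero] at hcs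
    exact hcs.elim hc0 hs.ne_zero
  obtain ⟨e, he, hJ⟩ := h c' hc' E
  have hmem := (J.frobPow (p ^ e)).mul_mem_left
    (algebraMap A _ s * algebraMap A _ t ^ p ^ e) (hE e he)
  rw [show algebraMap A (Localization S) s * algebraMap A _ t ^ p ^ e * (c * x ^ p ^ e) =
    algebraMap A _ (c' * u ^ p ^ e) by rw [map_mul, map_pow, ← hcs, ← hut]; ring,
    ← IsLocalization.map_under S _ J, ← Ideal.map_frobPow,
    IsLocalization.mem_map_algebraMap_iff S] at hmem
  obtain ⟨⟨⟨a, ha⟩, m⟩, hm⟩ := hmem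
  dsimp only at hm
  rw [← map_mul] at hm
  have hum := hJ _ (u * m) (by
    obtain ⟨n, hn⟩ := Nat.exists_eq_succ_of_ne_zero (pow_ne_zero e (Fact.out : p.Prime).ne_zero)
    rw [show c' * (u * m) ^ p ^ e = c' * u ^ p ^ e * m * m ^ n by
      rw [hn, Nat.succ_eq_add_one]; ring, hinj hm]
    exact Ideal.mul_mem_right _ _ ha)
  rw [Ideal.mem_comap, map_mul, ← hut] at hum
  have hu := ht.mul (IsLocalization.map_units (Localization S) m)
  rw [mul_assoc] at hum
  exact (Ideal.mul_unit_mem_iff_mem J hu).1 hum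

theorem maximalIdealNotAss_of_isCohenMacaulayLocal {T : Type*} [CommRing T] [IsLocalRing T]
    [IsNoetherianRing T] [IsAdicComplete (maximalIdeal T) T] (hT : IsCohenMacaulayLocal T)
    (hdim : 2 ≤ ringKrullDim T) :
    MaximalIdealNotAss T := by
  obtain ⟨l, hlM, hl, hlen⟩ := hT
  have hlen2 : 2 ≤ l.length := by
    rw [← hlen] at hdim
    exact Nat.cast_le.1 (WithBot.coe_le_coe.1 hdim)
  obtain ⟨n, hn⟩ := Nat.exists_eq_add_of_le' hlen2
  have hdepth := (Ideal.IsRegularChain.of_isRegular hl).hasDepth hlM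
  rw [hn] at hdepth
  rintro r hr hass
  by_cases hrM : r ∈ maximalIdeal T
  · rcases hr with rfl | hr
    · rw [Ideal.span_singleton_zero] at hass
      exact hdepth.isSocleFree.ne_of_isAssPrime hass rfl
    · have := hdepth.sup_span hrM (fun t ht => hr t ht)
      rw [bot_sup_eq] at this
      exact this.isSocleFree.ne_of_isAssPrime hass rfl
  · have hu : IsUnit r := by simpa using hrM
    obtain ⟨hprime, u, hu'⟩ := hass
    refine hprime.ne_top ((Ideal.eq_top_iff_one _).2 ((hu' 1).2 ?_))
    rw [Ideal.span_singleton_eq_top.2 hu]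
    trivial

/-- F-regular UFD precompletions of complete local reduced Gorenstein rings. -/
theorem FRegular_UFD_precompletion
    (T : Type*) [CommRing T] [IsLocalRing T] [IsNoetherianRing T]
    [IsAdicComplete (maximalIdeal T) T] [IsReduced T]
    (p : ℕ) (hp : p.Prime) [CharP T p]
    (hGor : IsGorensteinLocal T) (hdim : 2 ≤ ringKrullDim T)
    (I : Ideal T) (hIparam : IsParameterIdeal T I)
    (y : T) (hy : IsSocleGenerator I y)
    (h1 : ∃ E : ℕ, ∀ e : ℕ, E ≤ e → y ^ p ^ e ∉ I.frobPow (p ^ e))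
    (P : Ideal T) (hP : P.IsPrime) (hPm : P ≠ maximalIdeal T)
    (h2 : MIy p I y ⊆ (P : Set T)) :
    ∃ (A : Subring T) (_ : IsDomain A),
      UniqueFactorizationMonoid A ∧ IsNoetherianRing A ∧ IsLocalRing A ∧
      (Ideal.comap A.subtype (maximalIdeal T)).IsMaximal ∧
      FRegular A p ∧
      Nonempty (AdicCompletion (Ideal.comap A.subtype (maximalIdeal T)) A ≃+* T) := by
  have : Fact p.Prime := ⟨hp⟩
  obtain ⟨A, hA, hdense, hcomb⟩ := exists_isGoodSubring_dense hP hPm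
    (maximalIdealNotAss_of_isCohenMacaulayLocal hGor.1 hdim) p
  have hdomain := hA.isDomain
  have hcm := comap_map_subtype_of_isCombination hcomb
  have hnoeth := isNoetherianRing_of_comap_map A.subtype hcm
  have hM := map_comap_maximalIdeal hdense
  have hlocalHom := hA.isLocalHom_subtype
  have hlocal : IsLocalRing A := RingHom.domain_isLocalRing A.subtype
  refine ⟨A, hdomain, hA.uniqueFactorizationMonoid, hnoeth, hlocal, ?_, ?_, ?_⟩
  · have hcomap : (maximalIdeal T).comap A.subtype = maximalIdeal A :=
      ((local_hom_TFAE A.subtype).out 0 4).1 hlocalHom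
    rw [hcomap]
    exact maximalIdeal.isMaximal A
  · refine FRegular.of_forall fun c hc E => ?_
    have hcP : (c : T) ∉ MIy p I y := fun h => hc (Subtype.ext (hA.notMem c c.2 (h2 h)))
    simp only [MIy, Set.mem_ofPred_eq, not_exists, not_and, not_forall] at hcP
    obtain ⟨e, he, hce⟩ := hcP (max E 1) (le_max_right _ _)
    refine ⟨e, (le_max_left _ _).trans he, fun J u hu => ?_⟩
    rw [← hcm J, Ideal.mem_comap]
    refine mem_of_mul_pow_mem_frobPow hGor hIparam hy hce ?_
    rw [← Ideal.map_frobPow]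
    exact Ideal.mem_map_of_mem A.subtype hu
  · refine nonempty_adicCompletion_equiv A.subtype (fun n => ?_)
      (exists_sub_mem_pow (fun u => ?_) hM)
    · conv_lhs => rw [← hM, ← Ideal.map_pow, hcm]
    · obtain ⟨a, ha, hau⟩ := hdense u
      exact ⟨a, ha, Ideal.pow_le_self two_ne_zero hau⟩
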